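/- arXiv:1604.02244 — 2 statements merged into one kernel-verified Lean document; each statement's English description precedes it below -/
import Mathlib

section
/- Let $p\in(1,\infty)$, let $w\in A_p$ on $\mathbb{R}^n$, and let $b\in BMO(\mathbb{R}^n)$ be real-valued (more generally complex-valued, with $\Re$ denoting real part). There exist constants $\varepsilon_{n,p}, c_{n,p}>0$, depending only on $n$ and $p$, such that for every $z\in\mathbb{C}$ with $|z|\le \varepsilon_{n,p}/(\|b\|_{BMO}\,(w)_{A_p})$, the weight $e^{\Re(bz)}w$ belongs to $A_p$ with $[e^{\Re(bz)}w]_{A_p}\le c_{n,p}\,[w]_{A_p}$. -/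
open MeasureTheory ENNReal

noncomputable section

/-- An axis-parallel cube in `ℝⁿ` (with positive side length). -/
def IsCube {n : ℕ} (Q : Set (Fin n → ℝ)) : Prop :=
  ∃ (a : Fin n → ℝ) (h : ℝ), 0 < h ∧ Q = Set.Icc a (a + fun _ => h)

/-- Average of an `ℝ≥0∞`-valued function over a set. -/
def avgL {n : ℕ} (Q : Set (Fin n → ℝ)) (f : (Fin n → ℝ) → ℝ≥0∞) : ℝ≥0∞ :=
  (∫⁻ x in Q, f x) / volume Q

/-- Average of a real-valued function over a set. -/
def avgR {n : ℕ} (Q : Set (Fin n → ℝ)) (f : (Fin n → ℝ) → ℝ) : ℝ :=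
  (∫ x in Q, f x) / (volume Q).toReal

/-- The `A_p` product for a single cube. -/
def apTerm (n : ℕ) (p : ℝ) (w : (Fin n → ℝ) → ℝ) (Q : Set (Fin n → ℝ)) : ℝ≥0∞ :=
  avgL Q (fun x => ENNReal.ofReal (w x)) *
    avgL Q (fun x => ENNReal.ofReal (w x) ^ (1 - p / (p - 1))) ^ (p - 1)

/-- The Muckenhoupt `A_p` constant. -/
def apConst (n : ℕ) (p : ℝ) (w : (Fin n → ℝ) → ℝ) : ℝ≥0∞ :=
  ⨆ (Q : Set (Fin n → ℝ)) (_ : IsCube Q), apTerm n p w Q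

/-- A weight: locally integrable and a.e. positive. -/
def IsWeight (n : ℕ) (w : (Fin n → ℝ) → ℝ) : Prop :=
  LocallyIntegrable w volume ∧ ∀ᵐ x ∂(volume : Measure (Fin n → ℝ)), 0 < w x

/-- BMO norm of a real-valued function. -/
def bmoNorm (n : ℕ) (b : (Fin n → ℝ) → ℝ) : ℝ≥0∞ :=
  ⨆ (Q : Set (Fin n → ℝ)) (_ : IsCube Q),
    (∫⁻ x in Q, (‖b x - avgR Q b‖₊ : ℝ≥0∞)) / volume Q

/-- Weighted BMO norm of a real-valued function. -/
def bmoNormW (n : ℕ) (ν b : (Fin n → ℝ) → ℝ) : ℝ≥0∞ :=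
  ⨆ (Q : Set (Fin n → ℝ)) (_ : IsCube Q),
    (∫⁻ x in Q, (‖b x - avgR Q b‖₊ : ℝ≥0∞)) / (∫⁻ x in Q, ENNReal.ofReal (ν x))

/-- The (uncentered, cube-based) Hardy–Littlewood maximal operator. -/
def hlMax (n : ℕ) (f : (Fin n → ℝ) → ℝ≥0∞) (x : Fin n → ℝ) : ℝ≥0∞ :=
  ⨆ (Q : Set (Fin n → ℝ)) (_ : IsCube Q) (_ : x ∈ Q), avgL Q f

/-- The Fujii–Wilson `A_∞` constant. -/
def fwConst (n : ℕ) (w : (Fin n → ℝ) → ℝ) : ℝ≥0∞ :=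
  ⨆ (Q : Set (Fin n → ℝ)) (_ : IsCube Q),
    (∫⁻ x in Q, hlMax n (Q.indicator fun y => ENNReal.ofReal (w y)) x) /
      (∫⁻ x in Q, ENNReal.ofReal (w x))

/-- `(w)_{A_p} := max([w]_{A_∞}, [σ]_{A_∞})` where `σ = w^{1-p'}` is the dual weight. -/
def apMax (n : ℕ) (p : ℝ) (w : (Fin n → ℝ) → ℝ) : ℝ≥0∞ :=
  max (fwConst n w) (fwConst n (fun x => w x ^ (1 - p / (p - 1))))

/-- The `L^p(w)` (quasi-)norm. -/
def wNorm (n : ℕ) (p : ℝ) (w : (Fin n → ℝ) → ℝ) (f : (Fin n → ℝ) → ℝ) : ℝ≥0∞ :=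
  (∫⁻ x, (‖f x‖₊ : ℝ≥0∞) ^ p * ENNReal.ofReal (w x)) ^ (1 / p)

/-- The operator (quasi-)norm from `L^p(μ)` to `L^p(λ)`. -/
def opNormW (n : ℕ) (p : ℝ) (μ lam : (Fin n → ℝ) → ℝ)
    (S : ((Fin n → ℝ) → ℝ) → ((Fin n → ℝ) → ℝ)) : ℝ≥0∞ :=
  sInf {c : ℝ≥0∞ | ∀ f, wNorm n p lam (S f) ≤ c * wNorm n p μ f}

/-- The commutator `[b, S] = M_b ∘ S - S ∘ M_b`. -/
def commOp (n : ℕ) (b : (Fin n → ℝ) → ℝ)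
    (S : ((Fin n → ℝ) → ℝ) → ((Fin n → ℝ) → ℝ)) :
    ((Fin n → ℝ) → ℝ) → ((Fin n → ℝ) → ℝ) :=
  fun f x => b x * S f x - S (fun y => b y * f y) x


/-- Average of a complex-valued function over a set. -/
def avgC {n : ℕ} (Q : Set (Fin n → ℝ)) (f : (Fin n → ℝ) → ℂ) : ℂ :=
  (∫ x in Q, f x) / ((volume Q).toReal : ℂ)

/-- BMO norm of a complex-valued function. -/
def bmoNormC (n : ℕ) (b : (Fin n → ℝ) → ℂ) : ℝ≥0∞ :=
  ⨆ (Q : Set (Fin n → ℝ)) (_ : IsCube Q),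
    (∫⁻ x in Q, (‖b x - avgC Q b‖₊ : ℝ≥0∞)) / volume Q

/-- Index of the dyadic cell of generation `k` (relative to the cube with corner `a` and
side `h`) containing `x`. -/
def dyIdx {n : ℕ} (a : Fin n → ℝ) (h : ℝ) (k : ℕ) (x : Fin n → ℝ) : Fin n → ℤ :=
  fun i => ⌊(x i - a i) / h * 2 ^ k⌋

/-- Lower corner of a dyadic cell. -/
def dyCorner {n : ℕ} (a : Fin n → ℝ) (h : ℝ) (k : ℕ) (m : Fin n → ℤ) : Fin n → ℝ :=
  fun i => a i + h / 2 ^ k * m i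

/-- Half-open dyadic cell. -/
def dyCell {n : ℕ} (a : Fin n → ℝ) (h : ℝ) (k : ℕ) (m : Fin n → ℤ) : Set (Fin n → ℝ) :=
  {x | dyIdx a h k x = m}

/-- Closed dyadic cell. -/
def dyCube {n : ℕ} (a : Fin n → ℝ) (h : ℝ) (k : ℕ) (m : Fin n → ℤ) : Set (Fin n → ℝ) :=
  Set.Icc (dyCorner a h k m) (dyCorner a h k m + fun _ => h / 2 ^ k)

lemma dyIdx_succ {n : ℕ} (a : Fin n → ℝ) (h : ℝ) (k : ℕ) (x : Fin n → ℝ) (i : Fin n) :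
    dyIdx a h k x i = dyIdx a h (k + 1) x i / 2 := by
  have := Int.mul_cast_floor_div_cancel_of_pos (R := ℝ) (n := 2) (by norm_num)
    ((x i - a i) / h * 2 ^ k)
  simp only [dyIdx]
  rw [← this, pow_succ]
  push_cast
  ring_nf

lemma dyIdx_mono {n : ℕ} (a : Fin n → ℝ) (h : ℝ) {k l : ℕ} (hkl : k ≤ l) (x y : Fin n → ℝ)
    (hxy : dyIdx a h l x = dyIdx a h l y) : dyIdx a h k x = dyIdx a h k y := by
  induction l, hkl using Nat.le_induction with
  | base => exact hxy
  | succ l hl ih =>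
    apply ih
    funext i
    rw [dyIdx_succ a h l x, dyIdx_succ a h l y, hxy]

lemma dyCell_eq {n : ℕ} (a : Fin n → ℝ) {h : ℝ} (hh : 0 < h) (k : ℕ) (m : Fin n → ℤ) :
    dyCell a h k m = Set.pi Set.univ fun i =>
      Set.Ico (dyCorner a h k m i) ((dyCorner a h k m + fun _ => h / 2 ^ k : Fin n → ℝ) i) := by
  ext x
  simp only [dyCell, Set.mem_ofPred_eq, funext_iff, dyIdx, Int.floor_eq_iff, Set.mem_pi,
    Set.mem_univ, forall_true_left, Set.mem_Ico, Pi.add_apply, dyCorner]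
  refine forall_congr' fun i => ?_
  have h2 : (0 : ℝ) < 2 ^ k := by positivity
  have e1 : (x i - a i) / h * 2 ^ k = (x i - a i) / (h / 2 ^ k) := by field_simp
  rw [e1, le_div_iff₀ (by positivity), div_lt_iff₀ (by positivity)]
  constructor
  · rintro ⟨h1, h2⟩
    constructor <;> nlinarith
  · rintro ⟨h1, h2⟩
    constructor <;> nlinarith

lemma dyCell_ae {n : ℕ} (a : Fin n → ℝ) {h : ℝ} (hh : 0 < h) (k : ℕ) (m : Fin n → ℤ) :
    dyCell a h k m =ᵐ[volume] dyCube a h k m := by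
  rw [dyCell_eq a hh]
  exact Measure.univ_pi_Ico_ae_eq_Icc (μ := fun _ : Fin n => (volume : Measure ℝ))

lemma dyCell_meas {n : ℕ} (a : Fin n → ℝ) {h : ℝ} (hh : 0 < h) (k : ℕ) (m : Fin n → ℤ) :
    MeasurableSet (dyCell a h k m) := by
  rw [dyCell_eq a hh]
  exact MeasurableSet.univ_pi fun i => measurableSet_Ico

lemma vol_cube {n : ℕ} (a : Fin n → ℝ) (h : ℝ) :
    volume (Set.Icc a (a + fun _ => h)) = ENNReal.ofReal h ^ n := by
  rw [Real.volume_Icc_pi]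
  simp

lemma dyCube_isCube {n : ℕ} (a : Fin n → ℝ) {h : ℝ} (hh : 0 < h) (k : ℕ) (m : Fin n → ℤ) :
    IsCube (dyCube a h k m) := ⟨_, _, by positivity, rfl⟩

lemma vol_dyCube {n : ℕ} (a : Fin n → ℝ) (h : ℝ) (k : ℕ) (m : Fin n → ℤ) :
    volume (dyCube a h k m) = ENNReal.ofReal (h / 2 ^ k) ^ n := vol_cube _ _

lemma vol_dyCube_succ {n : ℕ} (a : Fin n → ℝ) (h : ℝ) (k : ℕ) (m m' : Fin n → ℤ) :
    volume (dyCube a h k m) = 2 ^ n * volume (dyCube a h (k + 1) m') := by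
  rw [vol_dyCube, vol_dyCube, ← mul_pow]
  congr 1
  rw [show h / 2 ^ k = 2 * (h / 2 ^ (k + 1)) by rw [pow_succ]; field_simp,
    ENNReal.ofReal_mul (by norm_num)]
  simp

lemma dyCube_zero {n : ℕ} (a : Fin n → ℝ) (h : ℝ) :
    dyCube a h 0 0 = Set.Icc a (a + fun _ => h) := by
  have : dyCorner a h 0 0 = a := by funext i; simp [dyCorner]
  simp [dyCube, this]

lemma dyCube_subset {n : ℕ} (a : Fin n → ℝ) {h : ℝ} (hh : 0 < h) (k : ℕ) (x : Fin n → ℝ)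
    (hx : dyIdx a h 0 x = 0) :
    dyCube a h k (dyIdx a h k x) ⊆ Set.Icc a (a + fun _ => h) := by
  have key : ∀ i, 0 ≤ dyIdx a h k x i ∧ (dyIdx a h k x i : ℝ) + 1 ≤ 2 ^ k := by
    intro i
    have h0 := congrFun hx i
    simp only [dyIdx, pow_zero, mul_one, Pi.zero_apply, Int.floor_eq_iff, Int.cast_zero,
      zero_add] at h0
    have h2 : (0 : ℝ) < 2 ^ k := by positivity
    refine ⟨Int.floor_nonneg.2 (mul_nonneg h0.1 h2.le), ?_⟩
    have : dyIdx a h k x i < 2 ^ k := by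
      rw [dyIdx, Int.floor_lt]
      push_cast
      nlinarith
    exact_mod_cast this
  apply Set.Icc_subset_Icc
  · intro i
    have := (key i).1
    simp only [dyCorner]
    have h3 : (0 : ℝ) ≤ (dyIdx a h k x i : ℝ) := by exact_mod_cast this
    have : 0 ≤ h / 2 ^ k * (dyIdx a h k x i : ℝ) := by positivity
    linarith
  · intro i
    simp only [dyCorner, Pi.add_apply]
    have : h / 2 ^ k * ((dyIdx a h k x i : ℝ) + 1) ≤ h / 2 ^ k * 2 ^ k :=
      mul_le_mul_of_nonneg_left (key i).2 (by positivity)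
    have e : h / 2 ^ k * 2 ^ k = h := by field_simp
    linarith

lemma dyCube_ball {n : ℕ} (a : Fin n → ℝ) {h : ℝ} (hh : 0 < h) (k : ℕ) (m : Fin n → ℤ) :
    dyCube a h k m = Metric.closedBall (dyCorner a h k m + fun _ => h / 2 ^ k / 2)
      (h / 2 ^ k / 2) := by
  ext x
  rw [Metric.mem_closedBall, dist_pi_le_iff (by positivity), dyCube, Set.mem_Icc, Pi.le_def,
    Pi.le_def, ← forall_and]
  refine forall_congr' fun i => ?_
  rw [Real.dist_eq, abs_le]
  simp only [Pi.add_apply]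
  constructor <;> rintro ⟨h1, h2⟩ <;> constructor <;> linarith

/-- One-step Calderon-Zygmund decomposition. -/
lemma cz_decomp {n : ℕ} (Q : Set (Fin n → ℝ)) (hQ : IsCube Q) (g : (Fin n → ℝ) → ℝ)
    (hg : LocallyIntegrable g volume) (hg0 : ∀ x, 0 ≤ g x) (B : ℝ) (hB : 0 < B)
    (hgB : ∫⁻ x in Q, ENNReal.ofReal (g x) ≤ ENNReal.ofReal B * volume Q) :
    ∃ E C : ℕ × (Fin n → ℤ) → Set (Fin n → ℝ),
      (∀ j, MeasurableSet (E j)) ∧ Pairwise (Function.onFun Disjoint E) ∧ (∀ j, E j ⊆ Q) ∧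
      (∀ j, E j = ∅ ∨ (E j =ᵐ[volume] C j ∧ IsCube (C j) ∧ C j ⊆ Q ∧
        ∫⁻ x in C j, ENNReal.ofReal (g x) ≤
          2 ^ n * (2 * ENNReal.ofReal B) * volume (C j))) ∧
      2 * volume (⋃ j, E j) ≤ volume Q ∧
      ∀ᵐ x ∂volume, x ∈ Q → x ∉ ⋃ j, E j → g x ≤ 2 * B := by
  obtain ⟨a, h, hh, rfl⟩ := hQ
  set bad : ℕ → (Fin n → ℤ) → Prop := fun k m =>
    2 * ENNReal.ofReal B * volume (dyCube a h k m) <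
      ∫⁻ x in dyCube a h k m, ENNReal.ofReal (g x) with hbad
  set E : ℕ × (Fin n → ℤ) → Set (Fin n → ℝ) := fun j =>
    {x | dyIdx a h j.1 x = j.2 ∧ dyIdx a h 0 x = 0 ∧ bad j.1 j.2 ∧
      ∀ l < j.1, ¬ bad l (dyIdx a h l x)} with hE
  have hB0 : ENNReal.ofReal B ≠ 0 := by simpa using hB
  have hBt : ENNReal.ofReal B ≠ ⊤ := ENNReal.ofReal_ne_top
  have hbad0 : ¬ bad 0 0 := by
    simp only [hbad, dyCube_zero, not_lt]
    refine hgB.trans ?_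
    gcongr
    rw [two_mul]
    exact le_self_add
  have hEcell : ∀ j x, x ∈ E j → E j = dyCell a h j.1 j.2 := by
    rintro ⟨k, m⟩ x ⟨h1, h2, h3, h4⟩
    ext y
    constructor
    · intro hy
      exact hy.1
    · intro hy
      have hy' : dyIdx a h k y = dyIdx a h k x := by rw [h1]; exact hy
      refine ⟨hy, ?_, h3, ?_⟩
      · rw [dyIdx_mono a h (Nat.zero_le k) y x hy', h2]
      · intro l hl
        rw [dyIdx_mono a h (le_of_lt hl) y x hy']
        exact h4 l hl
  have hEsub : ∀ j, E j ⊆ Set.Icc a (a + fun _ => h) := by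
    intro j x hx
    have : x ∈ dyCell a h 0 0 := hx.2.1
    rw [dyCell_eq a hh] at this
    rw [← dyCube_zero, dyCube, ← Set.pi_univ_Icc]
    exact fun i hi => Set.Ico_subset_Icc_self (this i hi)
  have hEmeas : ∀ j, MeasurableSet (E j) := by
    intro j
    rcases Set.eq_empty_or_nonempty (E j) with he | ⟨x, hx⟩
    · rw [he]; exact MeasurableSet.empty
    · rw [hEcell j x hx]; exact dyCell_meas a hh _ _
  have hEdisj : Pairwise (Function.onFun Disjoint E) := by
    rintro ⟨k, m⟩ ⟨k', m'⟩ hne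
    rw [Function.onFun, Set.disjoint_left]
    rintro x ⟨h1, h2, h3, h4⟩ ⟨h1', h2', h3', h4'⟩
    simp only at h1 h3 h4 h1' h3' h4'
    subst h1 h1'
    rcases lt_trichotomy k k' with hk | hk | hk
    · exact h4' k hk h3
    · subst hk; exact hne rfl
    · exact h4 k' hk h3'
  refine ⟨E, fun j => dyCube a h j.1 j.2, hEmeas, hEdisj, hEsub, ?_, ?_, ?_⟩
  · rintro ⟨k, m⟩
    rcases Set.eq_empty_or_nonempty (E (k, m)) with he | ⟨x, hx⟩
    · exact Or.inl he
    right
    refine ⟨?_, dyCube_isCube a hh _ _, ?_, ?_⟩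
    · rw [hEcell _ x hx]; exact dyCell_ae a hh _ _
    · have := dyCube_subset a hh k x hx.2.1
      rwa [hx.1] at this
    · obtain ⟨h1, h2, h3, h4⟩ := hx
      simp only at h1 h3 h4 ⊢
      cases k with
      | zero =>
        rw [h2] at h1
        subst h1
        exact absurd h3 hbad0
      | succ l =>
        have h5 := h4 l (Nat.lt_succ_self l)
        simp only [hbad, not_lt] at h5
        calc ∫⁻ x in dyCube a h (l + 1) m, ENNReal.ofReal (g x)
            = ∫⁻ x in dyCell a h (l + 1) m, ENNReal.ofReal (g x) :=
              (setLIntegral_congr (dyCell_ae a hh _ _)).symm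
          _ ≤ ∫⁻ x in dyCell a h l (dyIdx a h l x), ENNReal.ofReal (g x) := by
              apply lintegral_mono_set
              intro y hy
              exact dyIdx_mono a h (Nat.le_succ l) y x (by rw [h1]; exact hy)
          _ = ∫⁻ x in dyCube a h l (dyIdx a h l x), ENNReal.ofReal (g x) :=
              setLIntegral_congr (dyCell_ae a hh _ _)
          _ ≤ _ := h5
          _ = _ := by rw [vol_dyCube_succ a h l _ m]; ring
  · have h1 : ∀ j, 2 * ENNReal.ofReal B * volume (E j) ≤
        ∫⁻ x in E j, ENNReal.ofReal (g x) := by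
      intro j
      rcases Set.eq_empty_or_nonempty (E j) with he | ⟨x, hx⟩
      · rw [he]; simp
      · rw [hEcell j x hx, measure_congr (dyCell_ae a hh _ _),
          setLIntegral_congr (dyCell_ae a hh _ _)]
        exact hx.2.2.1.le
    have h2 : 2 * ENNReal.ofReal B * volume (⋃ j, E j) ≤
        ENNReal.ofReal B * volume (Set.Icc a (a + fun _ => h)) := by
      refine le_trans ?_ hgB
      refine le_trans ?_ (lintegral_mono_set (Set.iUnion_subset hEsub))
      rw [measure_iUnion hEdisj hEmeas, lintegral_iUnion hEmeas hEdisj, ← ENNReal.tsum_mul_left]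
      exact ENNReal.tsum_le_tsum h1
    rw [mul_comm 2, mul_assoc] at h2
    exact (ENNReal.mul_le_mul_iff_right hB0 hBt).1 h2
  · have hae := IsUnifLocDoublingMeasure.ae_tendsto_average (μ := volume) hg 1
    have hae2 : ∀ᵐ x ∂(volume : Measure (Fin n → ℝ)),
        x ∈ Set.Icc a (a + fun _ => h) → x ∈ dyCell a h 0 0 := by
      have := dyCell_ae a hh 0 (0 : Fin n → ℤ)
      rw [dyCube_zero] at this
      filter_upwards [this.mem_iff] with x hx
      exact hx.2
    filter_upwards [hae, hae2] with x hx hx2 hxQ hxE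
    have hx0 : dyIdx a h 0 x = 0 := hx2 hxQ
    have hgood : ∀ k, ¬ bad k (dyIdx a h k x) := by
      intro k
      induction k using Nat.strong_induction_on with
      | _ k ih =>
        intro hb
        exact hxE (Set.mem_iUnion.2 ⟨(k, dyIdx a h k x), rfl, hx0, hb, ih⟩)
    have hlim : Filter.Tendsto (fun k : ℕ => h / 2 ^ k / 2) Filter.atTop
        (nhdsWithin 0 (Set.Ioi 0)) := by
      rw [tendsto_nhdsWithin_iff]
      refine ⟨?_, Filter.Eventually.of_forall fun k => by simp only [Set.mem_Ioi]; positivity⟩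
      have := (tendsto_pow_atTop_nhds_zero_of_lt_one (r := (1 / 2 : ℝ)) (by norm_num)
        (by norm_num)).const_mul (h / 2)
      rw [mul_zero] at this
      refine this.congr fun k => ?_
      rw [one_div, inv_pow]
      field_simp
    have ht := hx (fun k : ℕ => dyCorner a h k (dyIdx a h k x) + fun _ => h / 2 ^ k / 2)
      (fun k => h / 2 ^ k / 2) hlim (Filter.Eventually.of_forall fun k => by
        rw [one_mul, ← dyCube_ball a hh]
        have : x ∈ dyCell a h k (dyIdx a h k x) := rfl
        rw [dyCell_eq a hh] at this
        rw [dyCube, ← Set.pi_univ_Icc]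
        exact fun i hi => Set.Ico_subset_Icc_self (this i hi))
    refine le_of_tendsto ht (Filter.Eventually.of_forall fun k => ?_)
    have h5 := hgood k
    simp only [hbad, not_lt] at h5
    rw [← dyCube_ball a hh]
    have hv0 : volume (dyCube a h k (dyIdx a h k x)) ≠ 0 := by
      rw [vol_dyCube]
      have : 0 < h / 2 ^ k := by positivity
      simp [this]
    have hvt : volume (dyCube a h k (dyIdx a h k x)) ≠ ⊤ := by
      rw [vol_dyCube]
      simp
    have hvp : 0 < (volume (dyCube a h k (dyIdx a h k x))).toReal := ENNReal.toReal_pos hv0 hvt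
    rw [setAverage_eq, smul_eq_mul, measureReal_def, inv_mul_le_iff₀ hvp,
      integral_eq_lintegral_of_nonneg_ae (Filter.Eventually.of_forall hg0)
        hg.aestronglyMeasurable.restrict]
    have h6 := ENNReal.toReal_mono (by finiteness) h5
    rw [ENNReal.toReal_mul, ENNReal.toReal_mul, ENNReal.toReal_ofReal hB.le] at h6
    simpa [mul_comm] using h6

lemma cube_vol_ne {n : ℕ} {Q : Set (Fin n → ℝ)} (hQ : IsCube Q) :
    volume Q ≠ 0 ∧ volume Q ≠ ⊤ := by
  obtain ⟨a, h, hh, rfl⟩ := hQ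
  rw [vol_cube]
  constructor
  · simp [hh]
  · simp

lemma cube_meas {n : ℕ} {Q : Set (Fin n → ℝ)} (hQ : IsCube Q) : MeasurableSet Q := by
  obtain ⟨a, h, hh, rfl⟩ := hQ
  exact measurableSet_Icc

lemma cube_compact {n : ℕ} {Q : Set (Fin n → ℝ)} (hQ : IsCube Q) : IsCompact Q := by
  obtain ⟨a, h, hh, rfl⟩ := hQ
  exact isCompact_Icc

lemma avg_sub_le {n : ℕ} {C : Set (Fin n → ℝ)} (hC : IsCube C) (b : (Fin n → ℝ) → ℂ)
    (hb : LocallyIntegrable b volume) (c : ℂ) (D : ℝ) (hD : 0 ≤ D)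
    (h : ∫⁻ x in C, ENNReal.ofReal ‖b x - c‖ ≤ ENNReal.ofReal D * volume C) :
    ‖avgC C b - c‖ ≤ D := by
  obtain ⟨hv0, hvt⟩ := cube_vol_ne hC
  have hvp : 0 < (volume C).toReal := ENNReal.toReal_pos hv0 hvt
  have hbi : IntegrableOn b C volume := hb.integrableOn_isCompact (cube_compact hC)
  have hci : IntegrableOn (fun _ => c) C volume := by
    simp [integrableOn_const_iff, lt_top_iff_ne_top, hvt]
  have e : avgC C b - c = (∫ x in C, (b x - c)) / ((volume C).toReal : ℂ) := by
    have hne : ((volume C).toReal : ℂ) ≠ 0 := by exact_mod_cast hvp.ne'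
    rw [integral_sub hbi hci, avgC]
    simp only [integral_const, measureReal_def, Measure.restrict_apply MeasurableSet.univ,
      Set.univ_inter, Complex.real_smul]
    field_simp
  rw [e, norm_div, Complex.norm_real, Real.norm_of_nonneg hvp.le, div_le_iff₀ hvp]
  refine (norm_integral_le_integral_norm _).trans ?_
  rw [integral_eq_lintegral_of_nonneg_ae (Filter.Eventually.of_forall fun x => norm_nonneg _)
    (show AEStronglyMeasurable (fun x => ‖b x - c‖) (volume.restrict C) from
      (hbi.sub hci).aestronglyMeasurable.norm)]
  have h6 := ENNReal.toReal_mono (by finiteness) h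
  rwa [ENNReal.toReal_mul, ENNReal.toReal_ofReal hD] at h6

/-- Truncated exponential functional. -/
def phiF {n : ℕ} (b : (Fin n → ℝ) → ℂ) (W : (Fin n → ℝ) → ℝ≥0∞) (t N : ℝ)
    (Q : Set (Fin n → ℝ)) : ℝ≥0∞ :=
  ∫⁻ x in Q, ENNReal.ofReal (Real.exp (t * min N ‖b x - avgC Q b‖) - 1) * W x

/-- The Fujii-Wilson numerator. -/
def amaxF {n : ℕ} (W : (Fin n → ℝ) → ℝ≥0∞) (Q : Set (Fin n → ℝ)) : ℝ≥0∞ :=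
  ∫⁻ x in Q, hlMax n (Q.indicator W) x

lemma hlMax_ge {n : ℕ} (W : (Fin n → ℝ) → ℝ≥0∞) {Q : Set (Fin n → ℝ)} (hQ : IsCube Q)
    {x : Fin n → ℝ} (hx : x ∈ Q) :
    (∫⁻ y in Q, W y) / volume Q ≤ hlMax n (Q.indicator W) x := by
  have : avgL Q (Q.indicator W) = (∫⁻ y in Q, W y) / volume Q := by
    rw [avgL, lintegral_indicator (cube_meas hQ), Measure.restrict_restrict (cube_meas hQ),
      Set.inter_self]
  rw [← this, hlMax]
  exact le_iSup_of_le Q (le_iSup_of_le hQ (le_iSup_of_le hx le_rfl))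

lemma hlMax_mono {n : ℕ} (W : (Fin n → ℝ) → ℝ≥0∞) {P Q : Set (Fin n → ℝ)} (hPQ : P ⊆ Q)
    (x : Fin n → ℝ) : hlMax n (P.indicator W) x ≤ hlMax n (Q.indicator W) x := by
  unfold hlMax avgL
  refine iSup_mono fun R => iSup_mono fun _ => iSup_mono fun _ => ?_
  gcongr

lemma amax_ge {n : ℕ} (W : (Fin n → ℝ) → ℝ≥0∞) {Q : Set (Fin n → ℝ)} (hQ : IsCube Q) :
    ∫⁻ x in Q, W x ≤ amaxF W Q := by
  obtain ⟨hv0, hvt⟩ := cube_vol_ne hQ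
  calc ∫⁻ x in Q, W x = (∫⁻ y in Q, W y) / volume Q * volume Q :=
        (ENNReal.div_mul_cancel hv0 hvt).symm
    _ = ∫⁻ x in Q, (∫⁻ y in Q, W y) / volume Q := by rw [setLIntegral_const]
    _ ≤ _ := setLIntegral_mono' (cube_meas hQ) fun x hx => hlMax_ge W hQ hx

lemma phi_step {n : ℕ} (b : (Fin n → ℝ) → ℂ) (hb : LocallyIntegrable b volume)
    (W : (Fin n → ℝ) → ℝ≥0∞) (hW : AEMeasurable W volume) (t N δ B : ℝ) (ht : 0 ≤ t)
    (hN : 0 ≤ N) (hδ : 0 < δ) (hB : 0 < B)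
    (hbB : ∀ Q : Set (Fin n → ℝ), IsCube Q →
      ∫⁻ x in Q, ENNReal.ofReal ‖b x - avgC Q b‖ ≤ ENNReal.ofReal B * volume Q)
    (hexp : Real.exp (t * (2 ^ n * (2 * B))) ≤ 1 + δ)
    (G : ℝ≥0∞) (hG : ∀ Q : Set (Fin n → ℝ), IsCube Q → phiF b W t N Q ≤ G * amaxF W Q)
    (Q : Set (Fin n → ℝ)) (hQ : IsCube Q) :
    ∃ S : ℝ≥0∞, phiF b W t N Q ≤
      ENNReal.ofReal δ * (∫⁻ x in Q, W x) + ENNReal.ofReal (1 + δ) * (G * S) ∧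
      2 * S + (∫⁻ x in Q, W x) ≤ 2 * amaxF W Q := by
  have hgi : LocallyIntegrable (fun x => ‖b x - avgC Q b‖) volume :=
    fun x => ((hb.sub (locallyIntegrable_const (avgC Q b))) x).norm
  obtain ⟨E, C, hEm, hEd, hEQ, hEC, hvol, hae⟩ := cz_decomp Q hQ (fun x => ‖b x - avgC Q b‖)
    hgi (fun x => norm_nonneg _) B hB (hbB Q hQ)
  set Ω := ⋃ j, E j with hΩ
  have hΩm : MeasurableSet Ω := MeasurableSet.iUnion hEm
  have hΩQ : Ω ⊆ Q := Set.iUnion_subset hEQ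
  have hQm := cube_meas hQ
  obtain ⟨hv0, hvt⟩ := cube_vol_ne hQ
  set MQ := hlMax n (Q.indicator W) with hMQ
  have split : ∀ F : (Fin n → ℝ) → ℝ≥0∞,
      ∫⁻ x in Q, F x = (∫⁻ x in Ω, F x) + ∫⁻ x in Q \ Ω, F x := by
    intro F
    rw [← lintegral_inter_add_sdiff F Q hΩm, Set.inter_eq_self_of_subset_right hΩQ]
  refine ⟨∫⁻ x in Ω, MQ x, ?_, ?_⟩
  · set F : (Fin n → ℝ) → ℝ≥0∞ := fun x =>
      ENNReal.ofReal (Real.exp (t * min N ‖b x - avgC Q b‖) - 1) * W x with hF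
    have h1 : ∀ j, ∫⁻ x in E j, F x ≤ ENNReal.ofReal δ * (∫⁻ x in E j, W x) +
        ENNReal.ofReal (1 + δ) * (G * ∫⁻ x in E j, MQ x) := by
      intro j
      rcases hEC j with he | ⟨h1, h2, h3, h4⟩
      · simp [he]
      have hd : ‖avgC (C j) b - avgC Q b‖ ≤ 2 ^ n * (2 * B) := by
        apply avg_sub_le h2 b hb _ _ (by positivity)
        refine h4.trans (le_of_eq ?_)
        rw [ENNReal.ofReal_mul (by positivity), ENNReal.ofReal_mul (by positivity),
          ENNReal.ofReal_pow (by positivity)]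
        simp
      have hpt : ∀ x, F x ≤ ENNReal.ofReal δ * W x + ENNReal.ofReal (1 + δ) *
          (ENNReal.ofReal (Real.exp (t * min N ‖b x - avgC (C j) b‖) - 1) * W x) := by
        intro x
        have hu : 0 ≤ Real.exp (t * min N ‖b x - avgC (C j) b‖) - 1 := by
          have : 0 ≤ t * min N ‖b x - avgC (C j) b‖ :=
            mul_nonneg ht (le_min hN (norm_nonneg _))
          linarith [Real.add_one_le_exp (t * min N ‖b x - avgC (C j) b‖)]
        have hmin : min N ‖b x - avgC Q b‖ ≤ min N ‖b x - avgC (C j) b‖ + 2 ^ n * (2 * B) := by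
          have htri : ‖b x - avgC Q b‖ ≤ ‖b x - avgC (C j) b‖ + ‖avgC (C j) b - avgC Q b‖ := by
            have := norm_add_le (b x - avgC (C j) b) (avgC (C j) b - avgC Q b)
            simpa using this
          have hpos : 0 ≤ 2 ^ n * (2 * B) := by positivity
          rcases min_cases N ‖b x - avgC (C j) b‖ with ⟨e, _⟩ | ⟨e, _⟩ <;> rw [e]
          · linarith [min_le_left N ‖b x - avgC Q b‖]
          · linarith [min_le_right N ‖b x - avgC Q b‖]
        have hee : Real.exp (t * min N ‖b x - avgC Q b‖) - 1 ≤
            δ + (1 + δ) * (Real.exp (t * min N ‖b x - avgC (C j) b‖) - 1) := by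
          have : Real.exp (t * min N ‖b x - avgC Q b‖) ≤
              Real.exp (t * min N ‖b x - avgC (C j) b‖) * Real.exp (t * (2 ^ n * (2 * B))) := by
            rw [← Real.exp_add, ← mul_add]
            exact Real.exp_le_exp.2 (mul_le_mul_of_nonneg_left hmin ht)
          have h7 := mul_le_mul_of_nonneg_left hexp
            (Real.exp_pos (t * min N ‖b x - avgC (C j) b‖)).le
          linarith
        simp only [hF]
        rw [← mul_assoc, ← add_mul, ← ENNReal.ofReal_mul (by positivity),
          ← ENNReal.ofReal_add hδ.le (mul_nonneg (by positivity) hu)]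
        gcongr
      calc ∫⁻ x in E j, F x ≤ ∫⁻ x in E j, (ENNReal.ofReal δ * W x + ENNReal.ofReal (1 + δ) *
          (ENNReal.ofReal (Real.exp (t * min N ‖b x - avgC (C j) b‖) - 1) * W x)) :=
            lintegral_mono hpt
        _ = ENNReal.ofReal δ * (∫⁻ x in E j, W x) + ENNReal.ofReal (1 + δ) *
            phiF b W t N (C j) := by
          rw [lintegral_add_left' (hW.restrict.const_mul _),
            lintegral_const_mul' _ _ ENNReal.ofReal_ne_top,
            lintegral_const_mul' _ _ ENNReal.ofReal_ne_top, phiF, setLIntegral_congr h1]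
          congr 2
          exact setLIntegral_congr h1
        _ ≤ _ := by
          gcongr
          refine (hG _ h2).trans ?_
          gcongr
          rw [amaxF, ← setLIntegral_congr h1]
          exact lintegral_mono fun x => hlMax_mono W h3 x
    have h2 : ∫⁻ x in Ω, F x ≤ ENNReal.ofReal δ * (∫⁻ x in Ω, W x) +
        ENNReal.ofReal (1 + δ) * (G * ∫⁻ x in Ω, MQ x) := by
      rw [hΩ, lintegral_iUnion hEm hEd, lintegral_iUnion hEm hEd, lintegral_iUnion hEm hEd,
        ← ENNReal.tsum_mul_left, ← ENNReal.tsum_mul_left, ← ENNReal.tsum_mul_left,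
        ← ENNReal.tsum_add]
      exact ENNReal.tsum_le_tsum h1
    have h3 : ∫⁻ x in Q \ Ω, F x ≤ ENNReal.ofReal δ * ∫⁻ x in Q \ Ω, W x := by
      rw [← lintegral_const_mul' _ _ ENNReal.ofReal_ne_top]
      apply lintegral_mono_ae
      rw [ae_restrict_iff' (hQm.diff hΩm)]
      filter_upwards [hae] with x hx hxm
      have h5 := hx hxm.1 hxm.2
      simp only [hF]
      gcongr
      have : t * min N ‖b x - avgC Q b‖ ≤ t * (2 ^ n * (2 * B)) := by
        apply mul_le_mul_of_nonneg_left _ ht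
        refine (min_le_right _ _).trans (h5.trans ?_)
        have : (1 : ℝ) ≤ 2 ^ n := one_le_pow₀ (by norm_num)
        nlinarith
      linarith [Real.exp_le_exp.2 this]
    rw [phiF, split F, split W, mul_add]
    calc _ ≤ _ := add_le_add h2 h3
      _ = _ := by ring
  · have h1 : (∫⁻ x in Q, W x) / volume Q * volume (Q \ Ω) ≤ ∫⁻ x in Q \ Ω, MQ x := by
      rw [← setLIntegral_const]
      exact setLIntegral_mono' (hQm.diff hΩm) fun x hx => hlMax_ge W hQ hx.1
    have h2 : volume Q ≤ 2 * volume (Q \ Ω) := by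
      have e : volume Q = volume Ω + volume (Q \ Ω) := by
        rw [← measure_inter_add_sdiff Q hΩm, Set.inter_eq_self_of_subset_right hΩQ]
      have hΩt : volume Ω ≠ ⊤ := ((measure_mono hΩQ).trans_lt (lt_top_iff_ne_top.2 hvt)).ne
      rw [e, two_mul] at hvol
      have h3 : volume Ω ≤ volume (Q \ Ω) := (ENNReal.add_le_add_iff_left hΩt).1 hvol
      rw [e, two_mul]
      gcongr
    have h3 : (∫⁻ x in Q, W x) ≤ 2 * ∫⁻ x in Q \ Ω, MQ x := by
      calc ∫⁻ x in Q, W x = (∫⁻ y in Q, W y) / volume Q * volume Q :=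
            (ENNReal.div_mul_cancel hv0 hvt).symm
        _ ≤ (∫⁻ y in Q, W y) / volume Q * (2 * volume (Q \ Ω)) := by gcongr
        _ = 2 * ((∫⁻ y in Q, W y) / volume Q * volume (Q \ Ω)) := by ring
        _ ≤ _ := by gcongr
    rw [amaxF, split (hlMax n (Q.indicator W)), mul_add]
    gcongr

lemma phi_bound {n : ℕ} (b : (Fin n → ℝ) → ℂ) (hb : LocallyIntegrable b volume)
    (W : (Fin n → ℝ) → ℝ≥0∞) (hW : AEMeasurable W volume) (t N δ B K : ℝ) (ht : 0 ≤ t)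
    (hN : 0 ≤ N) (hδ : 0 < δ) (hB : 0 < B) (hK : 0 < K)
    (hbB : ∀ Q : Set (Fin n → ℝ), IsCube Q →
      ∫⁻ x in Q, ENNReal.ofReal ‖b x - avgC Q b‖ ≤ ENNReal.ofReal B * volume Q)
    (hexp : Real.exp (t * (2 ^ n * (2 * B))) ≤ 1 + δ) (hδK : δ * K ≤ 1 / 4)
    (hW0 : ∀ Q : Set (Fin n → ℝ), IsCube Q → ∫⁻ x in Q, W x ≠ 0)
    (hWt : ∀ Q : Set (Fin n → ℝ), IsCube Q → ∫⁻ x in Q, W x ≠ ⊤)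
    (hWK : ∀ Q : Set (Fin n → ℝ), IsCube Q →
      amaxF W Q ≤ ENNReal.ofReal K * ∫⁻ x in Q, W x)
    (Q : Set (Fin n → ℝ)) (hQ : IsCube Q) :
    phiF b W t N Q ≤ ∫⁻ x in Q, W x := by
  have hAt : ∀ Q : Set (Fin n → ℝ), IsCube Q → amaxF W Q ≠ ⊤ := fun Q hQ =>
    ((hWK Q hQ).trans_lt (ENNReal.mul_lt_top ENNReal.ofReal_lt_top
      (lt_top_iff_ne_top.2 (hWt Q hQ)))).ne
  have hA0 : ∀ Q : Set (Fin n → ℝ), IsCube Q → amaxF W Q ≠ 0 := fun Q hQ h0 =>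
    hW0 Q hQ (le_antisymm ((amax_ge W hQ).trans h0.le) bot_le)
  have hpr : ∀ Q : Set (Fin n → ℝ), IsCube Q →
      phiF b W t N Q ≤ ENNReal.ofReal (Real.exp (t * N)) * ∫⁻ x in Q, W x := by
    intro Q hQ
    rw [phiF, ← lintegral_const_mul' _ _ ENNReal.ofReal_ne_top]
    apply lintegral_mono
    intro x
    dsimp only
    gcongr
    have : t * min N ‖b x - avgC Q b‖ ≤ t * N :=
      mul_le_mul_of_nonneg_left (min_le_left _ _) ht
    linarith [Real.exp_le_exp.2 this]
  set G : ℝ≥0∞ := ⨆ (Q : Set (Fin n → ℝ)) (_ : IsCube Q), phiF b W t N Q / amaxF W Q with hGdef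
  have hGt : G ≠ ⊤ := by
    refine ne_top_of_le_ne_top (b := ENNReal.ofReal (Real.exp (t * N))) ENNReal.ofReal_ne_top ?_
    refine iSup_le fun Q => iSup_le fun hQ => ?_
    rw [ENNReal.div_le_iff (hA0 Q hQ) (hAt Q hQ)]
    refine (hpr Q hQ).trans ?_
    gcongr
    exact amax_ge W hQ
  have hG : ∀ Q : Set (Fin n → ℝ), IsCube Q → phiF b W t N Q ≤ G * amaxF W Q := by
    intro Q hQ
    rw [← ENNReal.div_le_iff (hA0 Q hQ) (hAt Q hQ)]
    exact le_iSup_of_le Q (le_iSup_of_le hQ le_rfl)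
  have hg0 : 0 ≤ G.toReal := ENNReal.toReal_nonneg
  have hstep : ∀ Q : Set (Fin n → ℝ), IsCube Q → 0 < (∫⁻ x in Q, W x).toReal ∧
      (phiF b W t N Q).toReal ≤ G.toReal * (amaxF W Q).toReal
        + (δ - G.toReal / 4) * (∫⁻ x in Q, W x).toReal ∧
      (amaxF W Q).toReal ≤ K * (∫⁻ x in Q, W x).toReal := by
    intro Q hQ
    have hwp : 0 < (∫⁻ x in Q, W x).toReal := ENNReal.toReal_pos (hW0 Q hQ) (hWt Q hQ)
    obtain ⟨S, hS1, hS2⟩ := phi_step b hb W hW t N δ B ht hN hδ hB hbB hexp G hG Q hQ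
    have hAQ := hAt Q hQ
    have hWQ := hWt Q hQ
    have hSt : S ≠ ⊤ := by
      rintro rfl
      have : (2 : ℝ≥0∞) * amaxF W Q = ⊤ := by
        rw [← top_le_iff]
        refine le_trans ?_ hS2
        simp
      exact ENNReal.mul_ne_top (by norm_num) hAQ this
    have r1 := ENNReal.toReal_mono (by finiteness) hS1
    have r2 := ENNReal.toReal_mono (by finiteness) hS2
    have r3 := ENNReal.toReal_mono (by finiteness) (hWK Q hQ)
    rw [ENNReal.toReal_add (by finiteness) (by finiteness), ENNReal.toReal_mul,
      ENNReal.toReal_mul, ENNReal.toReal_mul, ENNReal.toReal_ofReal hδ.le,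
      ENNReal.toReal_ofReal (by positivity)] at r1
    rw [ENNReal.toReal_add (by finiteness) (by finiteness), ENNReal.toReal_mul,
      ENNReal.toReal_mul, ENNReal.toReal_ofNat] at r2
    rw [ENNReal.toReal_mul, ENNReal.toReal_ofReal hK.le] at r3
    refine ⟨hwp, ?_, r3⟩
    generalize (∫⁻ x in Q, W x).toReal = ω at *
    generalize (amaxF W Q).toReal = α at *
    generalize G.toReal = γ at *
    generalize S.toReal = s at *
    have q1 : (1 + δ) * (γ * s) ≤ (1 + δ) * (γ * (α - ω / 2)) := by
      have : s ≤ α - ω / 2 := by linarith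
      gcongr
    have q2 : δ * γ * α ≤ δ * γ * (K * ω) := by gcongr
    have q3 : (δ * K) * (γ * ω) ≤ 1 / 4 * (γ * ω) := by gcongr
    have q4 : 0 ≤ δ * γ * ω := by positivity
    nlinarith
  have hfin : G.toReal ≤ 4 * δ := by
    by_contra hcon
    push Not at hcon
    have hG' : G ≤ ENNReal.ofReal (G.toReal - (G.toReal / 4 - δ) / K) := by
      refine iSup_le fun Q => iSup_le fun hQ => ?_
      obtain ⟨hwp, h1, h2⟩ := hstep Q hQ
      have hap : 0 < (amaxF W Q).toReal := ENNReal.toReal_pos (hA0 Q hQ) (hAt Q hQ)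
      have hphit : phiF b W t N Q ≠ ⊤ :=
        ((hpr Q hQ).trans_lt (ENNReal.mul_lt_top ENNReal.ofReal_lt_top
          (lt_top_iff_ne_top.2 (hWt Q hQ)))).ne
      rw [ENNReal.le_ofReal_iff_toReal_le (ENNReal.div_ne_top hphit (hA0 Q hQ)) ?_,
        ENNReal.toReal_div, div_le_iff₀ hap]
      · have h3 : (amaxF W Q).toReal / K ≤ (∫⁻ x in Q, W x).toReal := by
          rw [div_le_iff₀ hK]; linarith
        have h4 : (G.toReal / 4 - δ) * ((amaxF W Q).toReal / K) ≤
            (G.toReal / 4 - δ) * (∫⁻ x in Q, W x).toReal :=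
          mul_le_mul_of_nonneg_left h3 (by linarith)
        have h5 : (G.toReal - (G.toReal / 4 - δ) / K) * (amaxF W Q).toReal =
          G.toReal * (amaxF W Q).toReal - (G.toReal / 4 - δ) * ((amaxF W Q).toReal / K) := by
          ring
        rw [h5]
        linarith
      · have hK1 : 1 ≤ K := by
          have h6 := ENNReal.toReal_mono (hAt Q hQ) (amax_ge W hQ)
          by_contra hlt
          push Not at hlt
          nlinarith
        have : (G.toReal / 4 - δ) / K ≤ G.toReal / 4 - δ :=
          div_le_self (by linarith) hK1
        linarith
    have h7 : (G.toReal / 4 - δ) / K > 0 := div_pos (by linarith) hK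
    have h9 : 0 < G.toReal := by linarith
    have h8 : G < G := by
      refine hG'.trans_lt ?_
      rw [ENNReal.ofReal_lt_iff_lt_toReal ?_ hGt]
      · linarith
      · by_contra hlt
        push Not at hlt
        have : G ≤ 0 := hG'.trans (by rw [ENNReal.ofReal_of_nonpos hlt.le])
        have h10 : G = 0 := le_antisymm this bot_le
        rw [h10] at h9
        simp at h9
    exact lt_irrefl _ h8
  calc phiF b W t N Q ≤ G * amaxF W Q := hG Q hQ
    _ ≤ ENNReal.ofReal (4 * δ) * (ENNReal.ofReal K * ∫⁻ x in Q, W x) := by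
      gcongr
      · exact (ENNReal.le_ofReal_iff_toReal_le hGt (by positivity)).2 hfin
      · exact hWK Q hQ
    _ = ENNReal.ofReal (4 * δ * K) * ∫⁻ x in Q, W x := by
      rw [ENNReal.ofReal_mul (p := 4 * δ) (by positivity), mul_assoc]
    _ ≤ 1 * ∫⁻ x in Q, W x := by
      gcongr
      rw [ENNReal.ofReal_le_one]
      linarith
    _ = _ := one_mul _

lemma exp_bound {n : ℕ} (b : (Fin n → ℝ) → ℂ) (hb : LocallyIntegrable b volume)
    (W : (Fin n → ℝ) → ℝ≥0∞) (hW : AEMeasurable W volume) (t B K : ℝ) (ht : 0 ≤ t)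
    (hB : 0 < B) (hK : 0 < K)
    (hbB : ∀ Q : Set (Fin n → ℝ), IsCube Q →
      ∫⁻ x in Q, ENNReal.ofReal ‖b x - avgC Q b‖ ≤ ENNReal.ofReal B * volume Q)
    (htK : t * (2 ^ n * (2 * B)) * K ≤ 1 / 8)
    (hW0 : ∀ Q : Set (Fin n → ℝ), IsCube Q → ∫⁻ x in Q, W x ≠ 0)
    (hWt : ∀ Q : Set (Fin n → ℝ), IsCube Q → ∫⁻ x in Q, W x ≠ ⊤)
    (hWK : ∀ Q : Set (Fin n → ℝ), IsCube Q →
      amaxF W Q ≤ ENNReal.ofReal K * ∫⁻ x in Q, W x)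
    (Q : Set (Fin n → ℝ)) (hQ : IsCube Q) :
    ∫⁻ x in Q, ENNReal.ofReal (Real.exp (t * ‖b x - avgC Q b‖)) * W x ≤
      2 * ∫⁻ x in Q, W x := by
  have hK1 : 1 ≤ K := by
    have hwp : 0 < (∫⁻ x in Q, W x).toReal := ENNReal.toReal_pos (hW0 Q hQ) (hWt Q hQ)
    have hWQ := hWt Q hQ
    have h6 := ENNReal.toReal_mono (by finiteness) ((amax_ge W hQ).trans (hWK Q hQ))
    rw [ENNReal.toReal_mul, ENNReal.toReal_ofReal hK.le] at h6
    by_contra hlt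
    push Not at hlt
    nlinarith
  have hy0 : 0 ≤ t * (2 ^ n * (2 * B)) := by positivity
  set y := t * (2 ^ n * (2 * B)) with hy
  have hy1 : y ≤ 1 / (8 * K) := by
    rw [le_div_iff₀ (by positivity)]
    linarith
  have hy2 : y ≤ 1 / 8 := by nlinarith
  have hexp : Real.exp y ≤ 1 + 1 / (4 * K) := by
    have h1 : |Real.exp y - 1| ≤ 2 * |y| := Real.abs_exp_sub_one_le (by
      rw [abs_of_nonneg hy0]; linarith)
    rw [abs_of_nonneg hy0] at h1
    have h2 := (abs_le.1 h1).2
    have h3 : 1 / (4 * K) = 2 * (1 / (8 * K)) := by field_simp; norm_num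
    linarith
  have hN : ∀ N : ℕ, ∫⁻ x in Q,
      ENNReal.ofReal (Real.exp (t * min (N : ℝ) ‖b x - avgC Q b‖)) * W x ≤
      2 * ∫⁻ x in Q, W x := by
    intro N
    have h1 := phi_bound b hb W hW t N (1 / (4 * K)) B K ht (by positivity) (by positivity) hB hK
      hbB hexp (by field_simp; norm_num) hW0 hWt hWK Q hQ
    calc _ ≤ ∫⁻ x in Q, (W x +
          ENNReal.ofReal (Real.exp (t * min (N : ℝ) ‖b x - avgC Q b‖) - 1) * W x) := by
          apply lintegral_mono
          intro x
          dsimp only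
          have : ENNReal.ofReal (Real.exp (t * min (N : ℝ) ‖b x - avgC Q b‖)) ≤ 1 +
              ENNReal.ofReal (Real.exp (t * min (N : ℝ) ‖b x - avgC Q b‖) - 1) := by
            rw [← ENNReal.ofReal_one]
            refine le_trans (ENNReal.ofReal_le_ofReal ?_) ENNReal.ofReal_add_le
            linarith
          calc _ ≤ _ := mul_le_mul_left this (W x)
            _ = _ := by ring
      _ = (∫⁻ x in Q, W x) + phiF b W t N Q := by
          rw [lintegral_add_left' hW.restrict, phiF]
      _ ≤ _ := by rw [two_mul]; gcongr
  have hlim : ∀ x, ENNReal.ofReal (Real.exp (t * ‖b x - avgC Q b‖)) * W x =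
      ⨆ N : ℕ, ENNReal.ofReal (Real.exp (t * min (N : ℝ) ‖b x - avgC Q b‖)) * W x := by
    intro x
    apply le_antisymm
    · obtain ⟨N, hNN⟩ := exists_nat_ge ‖b x - avgC Q b‖
      refine le_iSup_of_le N ?_
      rw [min_eq_right hNN]
    · refine iSup_le fun N => ?_
      gcongr
      exact min_le_right _ _
  simp_rw [hlim]
  rw [lintegral_iSup']
  · exact iSup_le hN
  · intro N
    have hbm : AEMeasurable b (volume.restrict Q) := hb.aestronglyMeasurable.aemeasurable.restrict
    have := hW.restrict (s := Q)
    fun_prop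
  · refine Filter.Eventually.of_forall fun x N N' hNN => ?_
    dsimp only
    gcongr

lemma exp_bound' {n : ℕ} (b : (Fin n → ℝ) → ℂ) (hb : LocallyIntegrable b volume)
    (hbt : bmoNormC n b ≠ ⊤)
    (W : (Fin n → ℝ) → ℝ≥0∞) (hW : AEMeasurable W volume) (t : ℝ) (κ : ℝ≥0∞) (ht : 0 ≤ t)
    (htK : bmoNormC n b = 0 ∨ t = 0 ∨ (bmoNormC n b ≠ 0 ∧ κ ≠ ⊤ ∧
      t * (2 ^ n * (2 * (bmoNormC n b).toReal)) * κ.toReal ≤ 1 / 8))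
    (hW0 : ∀ Q : Set (Fin n → ℝ), IsCube Q → ∫⁻ x in Q, W x ≠ 0)
    (hWt : ∀ Q : Set (Fin n → ℝ), IsCube Q → ∫⁻ x in Q, W x ≠ ⊤)
    (hWK : ∀ Q : Set (Fin n → ℝ), IsCube Q → amaxF W Q / (∫⁻ x in Q, W x) ≤ κ)
    (Q : Set (Fin n → ℝ)) (hQ : IsCube Q) :
    ∫⁻ x in Q, ENNReal.ofReal (Real.exp (t * ‖b x - avgC Q b‖)) * W x ≤
      2 * ∫⁻ x in Q, W x := by
  have hbB : ∀ Q : Set (Fin n → ℝ), IsCube Q →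
      ∫⁻ x in Q, ENNReal.ofReal ‖b x - avgC Q b‖ ≤ bmoNormC n b * volume Q := by
    intro Q hQ
    obtain ⟨hv0, hvt⟩ := cube_vol_ne hQ
    rw [← ENNReal.div_le_iff hv0 hvt]
    refine le_trans (le_of_eq ?_) (le_iSup_of_le Q (le_iSup_of_le hQ le_rfl))
    simp only [ofReal_norm, enorm_eq_nnnorm]
  have hone : (∫⁻ x in Q, W x) ≤ 2 * ∫⁻ x in Q, W x := by
    rw [two_mul]; exact le_self_add
  rcases htK with h0 | h0 | ⟨h0, h1, h2⟩
  · have h3 := hbB Q hQ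
    rw [h0, zero_mul, nonpos_iff_eq_zero, lintegral_eq_zero_iff'] at h3
    · refine le_trans (le_of_eq ?_) hone
      apply lintegral_congr_ae
      filter_upwards [h3] with x hx
      have : ‖b x - avgC Q b‖ = 0 := le_antisymm (by simpa using hx) (norm_nonneg _)
      simp [this]
    · have hbm : AEMeasurable b (volume.restrict Q) :=
        hb.aestronglyMeasurable.aemeasurable.restrict
      fun_prop
  · simpa [h0] using hone
  · have hκ1 : 1 ≤ κ := by
      refine le_trans ?_ (hWK Q hQ)
      rw [ENNReal.le_div_iff_mul_le (Or.inl (hW0 Q hQ)) (Or.inl (hWt Q hQ)), one_mul]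
      exact amax_ge W hQ
    have hκ0 : κ ≠ 0 := fun h => by simp [h] at hκ1
    apply exp_bound b hb W hW t (bmoNormC n b).toReal κ.toReal ht (ENNReal.toReal_pos h0 hbt)
      (ENNReal.toReal_pos hκ0 h1) _ h2 hW0 hWt _ Q hQ
    · intro Q hQ
      rw [ENNReal.ofReal_toReal hbt]
      exact hbB Q hQ
    · intro Q hQ
      rw [ENNReal.ofReal_toReal h1, ← ENNReal.div_le_iff (hW0 Q hQ) (hWt Q hQ)]
      exact hWK Q hQ

lemma pos_lint {n : ℕ} (w : (Fin n → ℝ) → ℝ≥0∞) (hw : AEMeasurable w volume)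
    (hpos : ∀ᵐ x ∂(volume : Measure (Fin n → ℝ)), 0 < w x) (Q : Set (Fin n → ℝ))
    (hQ : IsCube Q) : ∫⁻ x in Q, w x ≠ 0 := by
  intro h0
  rw [lintegral_eq_zero_iff' hw.restrict] at h0
  have h1 : ∀ᵐ x ∂(volume.restrict Q), False := by
    filter_upwards [h0, ae_restrict_of_ae hpos] with x hx hx2
    rw [hx] at hx2
    simp at hx2
  rw [Filter.eventually_false_iff_eq_bot, ae_eq_bot, Measure.restrict_eq_zero] at h1
  exact (cube_vol_ne hQ).1 h1

/-- For `w ∈ A_p` and `b ∈ BMO`, there are `ε_{n,p}, c_{n,p} > 0` such that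
`[e^{Re(bz)} w]_{A_p} ≤ c_{n,p} [w]_{A_p}` whenever `|z| ≤ ε_{n,p}/(‖b‖_{BMO} (w)_{A_p})`. -/
theorem exp_bmo_weight_Ap (n : ℕ) (p : ℝ) (hp : 1 < p) :
    ∃ ε c : ℝ, 0 < ε ∧ 0 < c ∧
      ∀ w : (Fin n → ℝ) → ℝ, IsWeight n w → apConst n p w ≠ ⊤ →
      ∀ b : (Fin n → ℝ) → ℂ, MeasureTheory.LocallyIntegrable b volume →
        bmoNormC n b ≠ ⊤ →
      ∀ z : ℂ,
        ENNReal.ofReal ‖z‖ ≤ ENNReal.ofReal ε / (bmoNormC n b * apMax n p w) →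
        apConst n p (fun x => Real.exp (b x * z).re * w x) ≤
          ENNReal.ofReal c * apConst n p w := by
  have hp1 : 0 < p - 1 := by linarith
  set s : ℝ := 1 / (p - 1) with hs
  have hs0 : 0 < s := by positivity
  have hse : 1 - p / (p - 1) = -s := by rw [hs]; field_simp; ring
  have hsp : s * (p - 1) = 1 := by rw [hs]; field_simp
  set M : ℝ := max 1 s with hM
  have hM1 : 1 ≤ M := le_max_left _ _
  have hMs : s ≤ M := le_max_right _ _
  refine ⟨1 / (8 * (2 ^ n * 2) * M), 2 * 2 ^ (p - 1), by positivity, by positivity, ?_⟩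
  intro w hw hwA b hb hbt z hz
  obtain ⟨hwi, hwp⟩ := hw
  set W1 : (Fin n → ℝ) → ℝ≥0∞ := fun x => ENNReal.ofReal (w x) with hW1
  set W2 : (Fin n → ℝ) → ℝ≥0∞ := fun x => ENNReal.ofReal (w x ^ (1 - p / (p - 1))) with hW2
  have hwm : AEMeasurable w volume := hwi.aestronglyMeasurable.aemeasurable
  have hm1 : AEMeasurable W1 volume := hwm.ennreal_ofReal
  have hm2 : AEMeasurable W2 volume := (hwm.pow_const _).ennreal_ofReal
  have h20 : ∀ Q : Set (Fin n → ℝ), IsCube Q → ∫⁻ x in Q, W2 x ≠ 0 := by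
    apply pos_lint W2 hm2
    filter_upwards [hwp] with x hx
    exact ENNReal.ofReal_pos.2 (Real.rpow_pos_of_pos hx _)
  have h10 : ∀ Q : Set (Fin n → ℝ), IsCube Q → ∫⁻ x in Q, W1 x ≠ 0 := by
    apply pos_lint W1 hm1
    filter_upwards [hwp] with x hx
    exact ENNReal.ofReal_pos.2 hx
  have h1t : ∀ Q : Set (Fin n → ℝ), IsCube Q → ∫⁻ x in Q, W1 x ≠ ⊤ := by
    intro Q hQ
    have h := (hwi.integrableOn_isCompact (cube_compact hQ)).lintegral_lt_top
    exact h.ne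
  have h2e : ∀ Q : Set (Fin n → ℝ),
      ∫⁻ x in Q, ENNReal.ofReal (w x) ^ (1 - p / (p - 1)) = ∫⁻ x in Q, W2 x := by
    intro Q
    apply lintegral_congr_ae
    filter_upwards [ae_restrict_of_ae hwp] with x hx
    exact ENNReal.ofReal_rpow_of_pos hx
  have hterm : ∀ Q : Set (Fin n → ℝ), apTerm n p w Q =
      (∫⁻ x in Q, W1 x) / volume Q * ((∫⁻ x in Q, W2 x) / volume Q) ^ (p - 1) := by
    intro Q
    rw [apTerm, avgL, avgL, h2e]
  have h2t : ∀ Q : Set (Fin n → ℝ), IsCube Q → ∫⁻ x in Q, W2 x ≠ ⊤ := by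
    intro Q hQ htop
    obtain ⟨hv0, hvt⟩ := cube_vol_ne hQ
    apply hwA
    rw [← top_le_iff]
    refine le_trans (le_of_eq ?_) (le_iSup_of_le Q (le_iSup_of_le hQ le_rfl))
    rw [hterm, htop, ENNReal.top_div_of_ne_top hvt, ENNReal.top_rpow_of_pos hp1,
      ENNReal.mul_top (ENNReal.div_ne_zero.2 ⟨h10 Q hQ, hvt⟩)]
  have hK1 : ∀ Q : Set (Fin n → ℝ), IsCube Q →
      amaxF W1 Q / (∫⁻ x in Q, W1 x) ≤ apMax n p w := by
    intro Q hQ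
    refine le_trans ?_ (le_max_left _ _)
    exact le_iSup_of_le Q (le_iSup_of_le hQ le_rfl)
  have hK2 : ∀ Q : Set (Fin n → ℝ), IsCube Q →
      amaxF W2 Q / (∫⁻ x in Q, W2 x) ≤ apMax n p w := by
    intro Q hQ
    refine le_trans ?_ (le_max_right _ _)
    exact le_iSup_of_le Q (le_iSup_of_le hQ le_rfl)
  have hcase : ∀ u : ℝ, 0 ≤ u → u ≤ M → bmoNormC n b = 0 ∨ u * ‖z‖ = 0 ∨ (bmoNormC n b ≠ 0 ∧
      apMax n p w ≠ ⊤ ∧ u * ‖z‖ * (2 ^ n * (2 * (bmoNormC n b).toReal)) *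
        (apMax n p w).toReal ≤ 1 / 8) := by
    intro u hu0 huM
    by_cases hβ : bmoNormC n b = 0
    · exact Or.inl hβ
    right
    by_cases hκ : apMax n p w = ⊤
    · left
      rw [hκ, ENNReal.mul_top hβ, ENNReal.div_top, nonpos_iff_eq_zero,
        ENNReal.ofReal_eq_zero] at hz
      have : ‖z‖ = 0 := le_antisymm hz (norm_nonneg _)
      rw [this, mul_zero]
    right
    refine ⟨hβ, hκ, ?_⟩
    have h1 : ENNReal.ofReal ‖z‖ * (bmoNormC n b * apMax n p w) ≤
        ENNReal.ofReal (1 / (8 * (2 ^ n * 2) * M)) :=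
      ENNReal.mul_le_of_le_div hz
    have h2 := ENNReal.toReal_mono ENNReal.ofReal_ne_top h1
    rw [ENNReal.toReal_mul, ENNReal.toReal_mul, ENNReal.toReal_ofReal (norm_nonneg _),
      ENNReal.toReal_ofReal (by positivity)] at h2
    have hX : 0 ≤ ‖z‖ * ((bmoNormC n b).toReal * (apMax n p w).toReal) := by positivity
    calc u * ‖z‖ * (2 ^ n * (2 * (bmoNormC n b).toReal)) * (apMax n p w).toReal
        = u * (2 ^ n * 2) * (‖z‖ * ((bmoNormC n b).toReal * (apMax n p w).toReal)) := by ring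
      _ ≤ M * (2 ^ n * 2) * (1 / (8 * (2 ^ n * 2) * M)) := by gcongr
      _ = 1 / 8 := by field_simp
  have hE1 := exp_bound' b hb hbt W1 hm1 (1 * ‖z‖) _ (by positivity)
    (hcase 1 zero_le_one hM1) h10 h1t hK1
  have hE2 := exp_bound' b hb hbt W2 hm2 (s * ‖z‖) _ (by positivity)
    (hcase s hs0.le hMs) h20 h2t hK2
  refine iSup_le fun Q => iSup_le fun hQ => ?_
  have hfin : apTerm n p (fun x => Real.exp (b x * z).re * w x) Q ≤
      ENNReal.ofReal (2 * 2 ^ (p - 1)) * apTerm n p w Q := by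
    set r : ℝ := (avgC Q b * z).re with hr
    have hre : ∀ x, |(b x * z).re - r| ≤ ‖z‖ * ‖b x - avgC Q b‖ := by
      intro x
      rw [hr, ← Complex.sub_re, ← sub_mul, mul_comm ‖z‖, ← norm_mul]
      exact Complex.abs_re_le_norm _
    have hA : ∫⁻ x in Q, ENNReal.ofReal (Real.exp (b x * z).re * w x) ≤
        ENNReal.ofReal (Real.exp r) * (2 * ∫⁻ x in Q, W1 x) := by
      refine le_trans ?_ (mul_le_mul_right (hE1 Q hQ) _)
      rw [← lintegral_const_mul' _ _ ENNReal.ofReal_ne_top]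
      apply lintegral_mono
      intro x
      dsimp only
      rw [ENNReal.ofReal_mul (Real.exp_pos _).le, ← mul_assoc,
        ← ENNReal.ofReal_mul (p := Real.exp r) (Real.exp_pos _).le, ← Real.exp_add]
      gcongr
      linarith [(abs_le.1 (hre x)).2]
    have hB : ∫⁻ x in Q, ENNReal.ofReal (Real.exp (b x * z).re * w x) ^ (1 - p / (p - 1)) ≤
        ENNReal.ofReal (Real.exp (-(s * r))) * (2 * ∫⁻ x in Q, W2 x) := by
      refine le_trans ?_ (mul_le_mul_right (hE2 Q hQ) _)
      rw [← lintegral_const_mul' _ _ ENNReal.ofReal_ne_top]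
      apply lintegral_mono_ae
      filter_upwards [ae_restrict_of_ae hwp] with x hx
      rw [ENNReal.ofReal_rpow_of_pos (by positivity),
        Real.mul_rpow (Real.exp_pos _).le hx.le, ← Real.exp_mul,
        ENNReal.ofReal_mul (Real.exp_pos _).le, ← mul_assoc,
        ← ENNReal.ofReal_mul (p := Real.exp (-(s * r))) (Real.exp_pos _).le, ← Real.exp_add]
      gcongr
      rw [hse]
      have := mul_le_mul_of_nonneg_left (neg_le.1 (abs_le.1 (hre x)).1) hs0.le
      linarith
    rw [hterm, apTerm, avgL, avgL]
    calc _ ≤ (ENNReal.ofReal (Real.exp r) * (2 * ∫⁻ x in Q, W1 x)) / volume Q *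
          ((ENNReal.ofReal (Real.exp (-(s * r))) * (2 * ∫⁻ x in Q, W2 x)) / volume Q)
            ^ (p - 1) := by gcongr
      _ = (ENNReal.ofReal (Real.exp r) * 2 * ((∫⁻ x in Q, W1 x) / volume Q)) *
          (ENNReal.ofReal (Real.exp (-(s * r))) * 2 * ((∫⁻ x in Q, W2 x) / volume Q))
            ^ (p - 1) := by
          simp only [div_eq_mul_inv, mul_assoc]
      _ = (ENNReal.ofReal (Real.exp r) * ENNReal.ofReal (Real.exp (-r))) *
          (2 * 2 ^ (p - 1)) * ((∫⁻ x in Q, W1 x) / volume Q *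
            ((∫⁻ x in Q, W2 x) / volume Q) ^ (p - 1)) := by
          rw [ENNReal.mul_rpow_of_nonneg _ _ hp1.le, ENNReal.mul_rpow_of_nonneg _ _ hp1.le,
            ENNReal.ofReal_rpow_of_pos (Real.exp_pos _), ← Real.exp_mul,
            show -(s * r) * (p - 1) = -r by linear_combination (-r) * hsp]
          ring
      _ ≤ _ := by
          rw [← ENNReal.ofReal_mul (Real.exp_pos _).le, ← Real.exp_add, add_neg_cancel,
            Real.exp_zero, ENNReal.ofReal_one, one_mul, ENNReal.ofReal_mul (by norm_num),
            ← ENNReal.ofReal_rpow_of_pos (by norm_num)]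
          simp
  refine hfin.trans ?_
  gcongr
  exact le_iSup_of_le Q (le_iSup_of_le hQ le_rfl)

end
end

section
/- (Sharp reverse H\"older inequality.) There is a constant $\varepsilon_n>0$, depending only on the dimension $n$, with the following property: if $w$ is a weight on $\mathbb{R}^n$ with $[w]_{A_\infty}<\infty$ and $1<q\le 1+\varepsilon_n/[w]_{A_\infty}$, then for every cube $Q\subset\mathbb{R}^n$, $\Big(\frac{1}{|Q|}\int_Q w^q\Big)^{1/q}\le 2\,\frac{1}{|Q|}\int_Q w$. -/
open MeasureTheory ENNReal

noncomputable section

namespace SRH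

/-- Index of the grid cell (of side `s`, anchored at `a`) containing `x`. -/
def idx {n : ℕ} (a : Fin n → ℝ) (s : ℝ) (x : Fin n → ℝ) : Fin n → ℤ :=
  fun i => ⌊(x i - a i) / s⌋

/-- Half-open grid cell. -/
def cell {n : ℕ} (a : Fin n → ℝ) (s : ℝ) (c : Fin n → ℤ) : Set (Fin n → ℝ) :=
  {x | idx a s x = c}

/-- Lower corner of a cell. -/
def low {n : ℕ} (a : Fin n → ℝ) (s : ℝ) (c : Fin n → ℤ) : Fin n → ℝ :=
  fun i => a i + c i * s

/-- Closed cube of a cell. -/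
def ccell {n : ℕ} (a : Fin n → ℝ) (s : ℝ) (c : Fin n → ℤ) : Set (Fin n → ℝ) :=
  Set.Icc (low a s c) (low a s c + fun _ => s)

lemma cell_eq {n : ℕ} (a : Fin n → ℝ) {s : ℝ} (hs : 0 < s) (c : Fin n → ℤ) :
    cell a s c = Set.pi Set.univ
      (fun i => Set.Ico (low a s c i) ((low a s c + (fun _ => s : Fin n → ℝ)) i)) := by
  ext x
  simp only [cell, idx, low, Set.mem_ofPred_eq, Set.mem_pi, Set.mem_univ, true_implies,
    Set.mem_Ico, Pi.add_apply, funext_iff]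
  refine forall_congr' fun i => ?_
  rw [Int.floor_eq_iff, le_div_iff₀ hs, div_lt_iff₀ hs]
  constructor <;> rintro ⟨h1, h2⟩ <;> constructor <;> linarith

lemma cell_ae {n : ℕ} (a : Fin n → ℝ) {s : ℝ} (hs : 0 < s) (c : Fin n → ℤ) :
    cell a s c =ᵐ[volume] ccell a s c := by
  rw [cell_eq a hs]
  exact Measure.univ_pi_Ico_ae_eq_Icc

lemma cell_subset {n : ℕ} (a : Fin n → ℝ) {s : ℝ} (hs : 0 < s) (c : Fin n → ℤ) :
    cell a s c ⊆ ccell a s c := by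
  rw [cell_eq a hs, ccell, ← Set.pi_univ_Icc]
  exact Set.pi_mono fun i _ => Set.Ico_subset_Icc_self

lemma isCube_ccell {n : ℕ} (a : Fin n → ℝ) {s : ℝ} (hs : 0 < s) (c : Fin n → ℤ) :
    IsCube (ccell a s c) := ⟨_, s, hs, rfl⟩

lemma volume_cell {n : ℕ} (a : Fin n → ℝ) {s : ℝ} (hs : 0 < s) (c : Fin n → ℤ) :
    volume (cell a s c) = ENNReal.ofReal s ^ n := by
  rw [cell_eq a hs, Real.volume_pi_Ico]
  simp

lemma measurable_idx {n : ℕ} (a : Fin n → ℝ) (s : ℝ) : Measurable (idx a s) := by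
  refine measurable_pi_lambda _ fun i => ?_
  exact Int.measurable_floor.comp (by fun_prop)

lemma measurableSet_cell {n : ℕ} (a : Fin n → ℝ) (s : ℝ) (c : Fin n → ℤ) :
    MeasurableSet (cell a s c) :=
  measurable_idx a s (measurableSet_singleton c)

lemma mem_cell_idx {n : ℕ} (a : Fin n → ℝ) (s : ℝ) (x : Fin n → ℝ) :
    x ∈ cell a s (idx a s x) := rfl

lemma idx_succ {n : ℕ} (a : Fin n → ℝ) (h : ℝ) (k : ℕ) {x y : Fin n → ℝ}
    (hxy : idx a (h / 2 ^ (k+1)) x = idx a (h / 2 ^ (k+1)) y) :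
    idx a (h / 2 ^ k) x = idx a (h / 2 ^ k) y := by
  have key : ∀ x : Fin n → ℝ, ∀ i, idx a (h / 2 ^ k) x i = idx a (h / 2 ^ (k+1)) x i / 2 := by
    intro x i
    have := Int.floor_div_natCast ((x i - a i) / (h / 2 ^ (k+1))) 2
    simp only [idx]
    rw [Nat.cast_ofNat] at this
    rw [← Nat.cast_ofNat (R := ℤ), ← this]
    congr 1
    rw [pow_succ]
    by_cases hh : h = 0
    · simp [hh]
    · field_simp
  funext i
  rw [key, key, hxy]

lemma idx_le {n : ℕ} (a : Fin n → ℝ) (h : ℝ) {j k : ℕ} (hjk : j ≤ k) {x y : Fin n → ℝ}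
    (hxy : idx a (h / 2 ^ k) x = idx a (h / 2 ^ k) y) :
    idx a (h / 2 ^ j) x = idx a (h / 2 ^ j) y := by
  induction k, hjk using Nat.le_induction with
  | base => exact hxy
  | succ k _ ih => exact ih (idx_succ a h k hxy)

/-- Dyadic average at level `k`. -/
def dav {n : ℕ} (W : (Fin n → ℝ) → ℝ≥0∞) (a : Fin n → ℝ) (h : ℝ) (k : ℕ) (x : Fin n → ℝ) : ℝ≥0∞ :=
  avgL (cell a (h / 2 ^ k) (idx a (h / 2 ^ k) x)) W

/-- Truncated dyadic maximal function. -/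
def dmax {n : ℕ} (W : (Fin n → ℝ) → ℝ≥0∞) (a : Fin n → ℝ) (h : ℝ) : ℕ → (Fin n → ℝ) → ℝ≥0∞
  | 0, x => dav W a h 0 x
  | k+1, x => max (dmax W a h k x) (dav W a h (k+1) x)

lemma measurable_dav {n : ℕ} (W : (Fin n → ℝ) → ℝ≥0∞) (a : Fin n → ℝ) (h : ℝ) (k : ℕ) :
    Measurable (dav W a h k) :=
  (Measurable.of_discrete (f := fun c => avgL (cell a (h / 2 ^ k) c) W)).comp
    (measurable_idx a (h / 2 ^ k))

lemma measurable_dmax {n : ℕ} (W : (Fin n → ℝ) → ℝ≥0∞) (a : Fin n → ℝ) (h : ℝ) (k : ℕ) :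
    Measurable (dmax W a h k) := by
  induction k with
  | zero => exact measurable_dav W a h 0
  | succ k ih => exact ih.max (measurable_dav W a h (k+1))

lemma dav_congr {n : ℕ} (W : (Fin n → ℝ) → ℝ≥0∞) (a : Fin n → ℝ) (h : ℝ) {j k : ℕ} (hjk : j ≤ k)
    {x y : Fin n → ℝ} (hxy : idx a (h / 2 ^ k) x = idx a (h / 2 ^ k) y) :
    dav W a h j x = dav W a h j y := by
  rw [dav, dav, idx_le a h hjk hxy]

lemma dmax_congr {n : ℕ} (W : (Fin n → ℝ) → ℝ≥0∞) (a : Fin n → ℝ) (h : ℝ) {j k : ℕ} (hjk : j ≤ k)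
    {x y : Fin n → ℝ} (hxy : idx a (h / 2 ^ k) x = idx a (h / 2 ^ k) y) :
    dmax W a h j x = dmax W a h j y := by
  induction j with
  | zero => exact dav_congr W a h hjk hxy
  | succ j ih => rw [dmax, dmax, ih (by omega), dav_congr W a h hjk hxy]

lemma dav_le_dmax {n : ℕ} (W : (Fin n → ℝ) → ℝ≥0∞) (a : Fin n → ℝ) (h : ℝ) {j k : ℕ} (hjk : j ≤ k)
    (x : Fin n → ℝ) : dav W a h j x ≤ dmax W a h k x := by
  induction k, hjk using Nat.le_induction with
  | base => cases j with
    | zero => exact le_rfl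
    | succ j => exact le_max_right _ _
  | succ k _ ih => exact ih.trans (le_max_left _ _)

lemma dmax_le {n : ℕ} (W : (Fin n → ℝ) → ℝ≥0∞) (a : Fin n → ℝ) (h : ℝ) (k : ℕ)
    (x : Fin n → ℝ) (B : ℝ≥0∞) (hB : ∀ j, dav W a h j x ≤ B) : dmax W a h k x ≤ B := by
  induction k with
  | zero => exact hB 0
  | succ k ih => exact max_le ih (hB _)

section
variable {n : ℕ} {W : (Fin n → ℝ) → ℝ≥0∞} {a : Fin n → ℝ} {h : ℝ}

lemma vol_ne_zero (a : Fin n → ℝ) {s : ℝ} (hs : 0 < s) (c : Fin n → ℤ) :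
    volume (cell a s c) ≠ 0 := by
  rw [volume_cell a hs]
  exact pow_ne_zero _ (by simpa using hs)

lemma vol_ne_top (a : Fin n → ℝ) {s : ℝ} (hs : 0 < s) (c : Fin n → ℤ) :
    volume (cell a s c) ≠ ⊤ := by
  rw [volume_cell a hs]
  exact ENNReal.pow_ne_top ENNReal.ofReal_ne_top

lemma lint_cell (W : (Fin n → ℝ) → ℝ≥0∞) (a : Fin n → ℝ) {s : ℝ} (hs : 0 < s) (c : Fin n → ℤ) :
    ∫⁻ x in cell a s c, W x = ∫⁻ x in ccell a s c, W x := by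
  rw [Measure.restrict_congr_set (cell_ae a hs c)]

lemma avg_cell (W : (Fin n → ℝ) → ℝ≥0∞) (a : Fin n → ℝ) {s : ℝ} (hs : 0 < s) (c : Fin n → ℤ) :
    avgL (cell a s c) W = avgL (ccell a s c) W := by
  rw [avgL, avgL, lint_cell W a hs, measure_congr (cell_ae a hs c)]

lemma hs (hh : 0 < h) (k : ℕ) : 0 < h / 2 ^ k := by positivity

lemma dav_ne_top (hW : ∀ Q : Set (Fin n → ℝ), IsCube Q → ∫⁻ x in Q, W x ≠ ⊤) (hh : 0 < h)
    (k : ℕ) (x : Fin n → ℝ) : dav W a h k x ≠ ⊤ := by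
  rw [dav, avgL]
  refine ENNReal.div_ne_top ?_ (vol_ne_zero a (hs hh k) _)
  rw [lint_cell W a (hs hh k)]
  exact hW _ (isCube_ccell a (hs hh k) _)

lemma dmax_ne_top (hW : ∀ Q : Set (Fin n → ℝ), IsCube Q → ∫⁻ x in Q, W x ≠ ⊤) (hh : 0 < h)
    (k : ℕ) (x : Fin n → ℝ) : dmax W a h k x ≠ ⊤ := by
  induction k with
  | zero => exact dav_ne_top hW hh 0 x
  | succ k ih =>
    rw [dmax]
    exact (max_lt ih.lt_top (dav_ne_top hW hh _ x).lt_top).ne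

lemma dav_succ_le (hh : 0 < h) (k : ℕ) (x : Fin n → ℝ) :
    dav W a h (k+1) x ≤ 2 ^ n * dav W a h k x := by
  have h1 : volume (cell a (h / 2 ^ k) (idx a (h / 2 ^ k) x)) =
      2 ^ n * volume (cell a (h / 2 ^ (k+1)) (idx a (h / 2 ^ (k+1)) x)) := by
    rw [volume_cell a (hs hh k), volume_cell a (hs hh (k+1)), ← mul_pow]
    congr 1
    rw [← ENNReal.ofReal_ofNat 2, ← ENNReal.ofReal_mul (by norm_num)]
    congr 1
    rw [pow_succ]; field_simp
  rw [dav, dav, avgL, avgL, h1, ENNReal.div_eq_inv_mul, ENNReal.div_eq_inv_mul,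
    ENNReal.mul_inv (by simp) (by simp), ← mul_assoc, ← mul_assoc,
    ENNReal.mul_inv_cancel (by simp) (by simp), one_mul]
  gcongr
  intro y hy
  exact idx_succ a h k hy

/-- cellwise comparison -/
lemma lint_le_of_cells (k : ℕ) (c₀ : Fin n → ℤ) (F G : (Fin n → ℝ) → ℝ≥0∞)
    (H : ∀ c, ∫⁻ x in cell a (h / 2 ^ k) c, F x ≤ ∫⁻ x in cell a (h / 2 ^ k) c, G x) :
    ∫⁻ x in cell a (h / 2 ^ 0) c₀, F x ≤ ∫⁻ x in cell a (h / 2 ^ 0) c₀, G x := by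
  let T : Set (Fin n → ℤ) := {c | ∃ x ∈ cell a (h / 2 ^ 0) c₀, idx a (h / 2 ^ k) x = c}
  have e : cell a (h / 2 ^ 0) c₀ = ⋃ c : T, cell a (h / 2 ^ k) c := by
    ext x
    simp only [Set.mem_iUnion]
    constructor
    · intro hx
      exact ⟨⟨_, x, hx, rfl⟩, rfl⟩
    · rintro ⟨⟨c, y, hy, rfl⟩, hx⟩
      have hx : idx a (h / 2 ^ k) x = idx a (h / 2 ^ k) y := hx
      exact (idx_le a h (Nat.zero_le k) hx).trans hy
  have hd : Pairwise (Function.onFun Disjoint fun c : T => cell a (h / 2 ^ k) (c : Fin n → ℤ)) := by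
    intro c d hcd
    refine Set.disjoint_left.2 fun x hx hx' => hcd ?_
    exact Subtype.ext (Eq.trans (Eq.symm hx) hx')
  rw [e, lintegral_iUnion (fun c => measurableSet_cell a _ _) hd,
    lintegral_iUnion (fun c => measurableSet_cell a _ _) hd]
  exact ENNReal.tsum_le_tsum fun c => H c

lemma pw_real {A B C e : ℝ} (he : 0 < e) (hB : 0 < B) (hBA : B ≤ A) (hA : A ≤ C * B) :
    (A ^ e - B ^ e) * A ≤ C * e * (A ^ (1 + e) - B ^ (1 + e)) := by
  have hA0 : 0 < A := hB.trans_le hBA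
  have hC : 0 ≤ C := by
    by_contra hc
    nlinarith
  have h1 : 1 + e * (1 - A / B) ≤ (B / A) ^ e := by
    rw [Real.rpow_def_of_pos (by positivity)]
    have := Real.add_one_le_exp (Real.log (B / A) * e)
    have h2 := Real.one_sub_inv_le_log_of_pos (show 0 < B / A by positivity)
    rw [inv_div] at h2
    nlinarith
  rw [Real.div_rpow hB.le hA0.le, le_div_iff₀ (by positivity)] at h1
  have h3 : A ^ e - B ^ e ≤ A ^ e * e * ((A - B) / B) := by
    have : (A - B) / B = A / B - 1 := by field_simp
    rw [this]; nlinarith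
  have h4 : B ^ (1 + e) ≤ A ^ e * B := by
    rw [add_comm, Real.rpow_add hB, Real.rpow_one]
    gcongr
  have h5 : A ^ (1 + e) = A ^ e * A := by
    rw [add_comm, Real.rpow_add hA0, Real.rpow_one]
  have hAe : 0 < A ^ e := by positivity
  calc (A ^ e - B ^ e) * A ≤ (A ^ e * e * ((A - B) / B)) * A := by gcongr
    _ ≤ (A ^ e * e * ((A - B) / B)) * (C * B) := by
        have : 0 ≤ A - B := by linarith
        gcongr
    _ = C * e * (A ^ e * A - A ^ e * B) := by field_simp
    _ ≤ _ := by rw [h5]; gcongr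

lemma pw {A B I K v D : ℝ≥0∞} {C e : ℝ} (he : 0 < e) (hA' : A ≠ ⊤) (hI' : I ≠ ⊤) (hK' : K ≠ ⊤)
    (hv : v ≠ ⊤) (hC : 0 ≤ C) (hD : D = ENNReal.ofReal (C * e)) (hBA : B ≤ A)
    (hA : A ≤ ENNReal.ofReal C * B) (hI : B < A → I ≤ K * (A * v)) :
    A ^ e * I + K * D * (B ^ (1 + e) * v) ≤ B ^ e * I + K * D * (A ^ (1 + e) * v) := by
  rcases hBA.eq_or_lt with rfl | hlt
  · exact le_rfl
  specialize hI hlt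
  have hB' : B ≠ ⊤ := (hBA.trans_lt hA'.lt_top).ne
  have hB0 : B ≠ 0 := by
    rintro rfl
    simp at hA
    simp [hA] at hlt
  subst hD
  lift A to NNReal using hA'
  lift B to NNReal using hB'
  lift I to NNReal using hI'
  lift K to NNReal using hK'
  lift v to NNReal using hv
  rw [ENNReal.ofReal] at hA ⊢
  rw [← ENNReal.coe_rpow_of_nonneg _ he.le, ← ENNReal.coe_rpow_of_nonneg _ he.le,
    ← ENNReal.coe_rpow_of_nonneg _ (by linarith : 0 ≤ 1 + e),
    ← ENNReal.coe_rpow_of_nonneg _ (by linarith : 0 ≤ 1 + e)]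
  norm_cast at hA hI hBA hB0 ⊢
  rw [← NNReal.coe_le_coe] at hA hI hBA ⊢
  push_cast at hA hI ⊢
  rw [Real.coe_toNNReal _ hC] at hA
  rw [Real.coe_toNNReal _ (by positivity)]
  have hBp : (0:ℝ) < B := by positivity
  have h1 := pw_real he hBp hBA hA
  have h2 : (B:ℝ) ^ e ≤ (A:ℝ) ^ e := by gcongr
  have h3 : ((A:ℝ) ^ e - (B:ℝ) ^ e) * I ≤ ((A:ℝ) ^ e - (B:ℝ) ^ e) * (K * (A * v)) :=
    mul_le_mul_of_nonneg_left hI (by linarith)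
  have h4 := mul_le_mul_of_nonneg_left h1 (by positivity : (0:ℝ) ≤ K * v)
  nlinarith


lemma dav_mul_vol (hh : 0 < h) (k : ℕ) (x : Fin n → ℝ) :
    dav W a h k x * volume (cell a (h / 2 ^ k) (idx a (h / 2 ^ k) x)) =
      ∫⁻ y in cell a (h / 2 ^ k) (idx a (h / 2 ^ k) x), W y := by
  rw [dav, avgL]
  exact ENNReal.div_mul_cancel (vol_ne_zero a (hs hh k) _) (vol_ne_top a (hs hh k) _)

lemma dmax_mono_succ (k : ℕ) (x : Fin n → ℝ) : dmax W a h k x ≤ dmax W a h (k+1) x :=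
  le_max_left _ _

lemma dmax_succ_le (hh : 0 < h) (k : ℕ) (x : Fin n → ℝ) :
    dmax W a h (k+1) x ≤ 2 ^ n * dmax W a h k x := by
  rw [dmax]
  refine max_le ?_ ((dav_succ_le hh k x).trans ?_)
  · exact le_mul_of_one_le_left' (one_le_pow₀ (by norm_num))
  · gcongr
    exact dav_le_dmax W a h le_rfl x

lemma dmax_bound (hh : 0 < h) (k : ℕ) (x : Fin n → ℝ) :
    dmax W a h k x ≤ (2 ^ n) ^ k * dav W a h 0 x := by
  induction k with
  | zero => simp [dmax]
  | succ k ih =>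
    refine (dmax_succ_le hh k x).trans ?_
    rw [pow_succ', mul_assoc]
    gcongr

lemma int_dmax_ne_top (hW : ∀ Q : Set (Fin n → ℝ), IsCube Q → ∫⁻ x in Q, W x ≠ ⊤) (hh : 0 < h)
    {e : ℝ} (he : 0 < e) (k : ℕ) (c₀ : Fin n → ℤ) :
    ∫⁻ x in cell a (h / 2 ^ 0) c₀, dmax W a h k x ^ (1 + e) ≠ ⊤ := by
  have hpos : 0 ≤ 1 + e := by linarith
  have hfin : avgL (cell a (h / 2 ^ 0) c₀) W ≠ ⊤ := by
    rw [avgL]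
    refine ENNReal.div_ne_top ?_ (vol_ne_zero a (hs hh 0) _)
    rw [lint_cell W a (hs hh 0)]
    exact hW _ (isCube_ccell a (hs hh 0) _)
  have : ∫⁻ x in cell a (h / 2 ^ 0) c₀, dmax W a h k x ^ (1 + e) ≤
      ∫⁻ x in cell a (h / 2 ^ 0) c₀, ((2 ^ n) ^ k * avgL (cell a (h / 2 ^ 0) c₀) W) ^ (1 + e) := by
    refine setLIntegral_mono' (measurableSet_cell _ _ _) fun x hx => ?_
    refine ENNReal.rpow_le_rpow ((dmax_bound hh k x).trans_eq ?_) hpos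
    have hx : idx a (h / 2 ^ 0) x = c₀ := hx
    rw [dav, hx]
  refine (this.trans_lt ?_).ne
  rw [setLIntegral_const]
  refine ENNReal.mul_lt_top (ENNReal.rpow_lt_top_of_nonneg hpos ?_) (vol_ne_top a (hs hh 0) _).lt_top
  exact ENNReal.mul_ne_top (by simp) hfin

lemma step (hW : ∀ Q : Set (Fin n → ℝ), IsCube Q → ∫⁻ x in Q, W x ≠ ⊤) (hh : 0 < h)
    {e : ℝ} (he : 0 < e) {K : ℝ≥0∞} (hK : K ≠ ⊤) (V : (Fin n → ℝ) → ℝ≥0∞)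
    (hVf : ∀ k c, ∫⁻ x in cell a (h / 2 ^ k) c, V x ≠ ⊤)
    (hV : ∀ k x, dmax W a h k x < dav W a h (k+1) x →
      ∫⁻ y in cell a (h / 2 ^ (k+1)) (idx a (h / 2 ^ (k+1)) x), V y ≤
        K * ∫⁻ y in cell a (h / 2 ^ (k+1)) (idx a (h / 2 ^ (k+1)) x), W y)
    {D : ℝ≥0∞} (hD : D = ENNReal.ofReal (2 ^ n * e)) (k : ℕ) (c₀ : Fin n → ℤ) :
    (∫⁻ x in cell a (h / 2 ^ 0) c₀, dmax W a h (k+1) x ^ e * V x) +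
      K * D * ∫⁻ x in cell a (h / 2 ^ 0) c₀, dmax W a h k x ^ (1 + e) ≤
    (∫⁻ x in cell a (h / 2 ^ 0) c₀, dmax W a h k x ^ e * V x) +
      K * D * ∫⁻ x in cell a (h / 2 ^ 0) c₀, dmax W a h (k+1) x ^ (1 + e) := by
  have mm : ∀ k, Measurable fun x => dmax W a h k x ^ (1 + e) :=
    fun k => (measurable_dmax W a h k).pow_const _
  rw [← lintegral_const_mul _ (mm k), ← lintegral_const_mul _ (mm (k+1)),
    ← lintegral_add_right _ ((mm k).const_mul _), ← lintegral_add_right _ ((mm (k+1)).const_mul _)]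
  refine lint_le_of_cells (k+1) c₀ _ _ fun c => ?_
  obtain ⟨x₀, hx₀⟩ : (cell a (h / 2 ^ (k+1)) c).Nonempty :=
    nonempty_of_measure_ne_zero (vol_ne_zero a (hs hh (k+1)) c)
  have hx₀ : idx a (h / 2 ^ (k+1)) x₀ = c := hx₀
  subst hx₀
  set P := cell a (h / 2 ^ (k+1)) (idx a (h / 2 ^ (k+1)) x₀) with hP
  have hcomp : ∀ i j, i ≤ k + 1 → j ≤ k + 1 →
      ∫⁻ x in P, (dmax W a h i x ^ e * V x + K * D * dmax W a h j x ^ (1 + e)) =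
      dmax W a h i x₀ ^ e * (∫⁻ x in P, V x) +
        K * D * (dmax W a h j x₀ ^ (1 + e) * volume P) := by
    intro i j hi hj
    have : ∫⁻ x in P, (dmax W a h i x ^ e * V x + K * D * dmax W a h j x ^ (1 + e)) =
        ∫⁻ x in P, (dmax W a h i x₀ ^ e * V x + K * D * dmax W a h j x₀ ^ (1 + e)) := by
      refine setLIntegral_congr_fun (measurableSet_cell _ _ _) fun x hx => ?_
      have hx : idx a (h / 2 ^ (k+1)) x = idx a (h / 2 ^ (k+1)) x₀ := hx
      simp only [dmax_congr W a h hi hx, dmax_congr W a h hj hx]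
    rw [this, lintegral_add_right _ measurable_const, setLIntegral_const, lintegral_const_mul',
      mul_assoc (K * D)]
    exact (ENNReal.rpow_lt_top_of_nonneg he.le (dmax_ne_top hW hh i x₀)).ne
  rw [hcomp (k+1) k le_rfl (by omega), hcomp k (k+1) (by omega) le_rfl]
  refine pw he (dmax_ne_top hW hh _ _) (hVf _ _) hK (vol_ne_top a (hs hh (k+1)) _)
    (by positivity : (0:ℝ) ≤ 2 ^ n) hD (dmax_mono_succ k x₀) ?_ ?_
  · refine (dmax_succ_le hh k x₀).trans_eq ?_
    rw [ENNReal.ofReal_pow (by norm_num)]; simp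
  · intro hlt
    have hlt' : dmax W a h k x₀ < dav W a h (k+1) x₀ := by
      rw [dmax] at hlt
      exact (lt_max_iff.1 hlt).resolve_left (lt_irrefl _)
    have e1 : dmax W a h (k+1) x₀ = dav W a h (k+1) x₀ := by
      rw [dmax]; exact max_eq_right hlt'.le
    rw [e1, dav_mul_vol hh]
    exact hV k x₀ hlt'

lemma iter (hW : ∀ Q : Set (Fin n → ℝ), IsCube Q → ∫⁻ x in Q, W x ≠ ⊤) (hh : 0 < h)
    {e : ℝ} (he : 0 < e) {K : ℝ≥0∞} (hK : K ≠ ⊤) (V : (Fin n → ℝ) → ℝ≥0∞)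
    (hVf : ∀ k c, ∫⁻ x in cell a (h / 2 ^ k) c, V x ≠ ⊤)
    (hV : ∀ k x, dmax W a h k x < dav W a h (k+1) x →
      ∫⁻ y in cell a (h / 2 ^ (k+1)) (idx a (h / 2 ^ (k+1)) x), V y ≤
        K * ∫⁻ y in cell a (h / 2 ^ (k+1)) (idx a (h / 2 ^ (k+1)) x), W y)
    {D : ℝ≥0∞} (hD : D = ENNReal.ofReal (2 ^ n * e)) (k : ℕ) (c₀ : Fin n → ℤ) :
    ∫⁻ x in cell a (h / 2 ^ 0) c₀, dmax W a h k x ^ e * V x ≤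
    avgL (cell a (h / 2 ^ 0) c₀) W ^ e * (∫⁻ x in cell a (h / 2 ^ 0) c₀, V x) +
      K * D * ∫⁻ x in cell a (h / 2 ^ 0) c₀, dmax W a h k x ^ (1 + e) := by
  induction k with
  | zero =>
    refine le_trans (le_of_eq ?_) le_self_add
    have hfin : avgL (cell a (h / 2 ^ 0) c₀) W ≠ ⊤ := by
      rw [avgL]
      refine ENNReal.div_ne_top ?_ (vol_ne_zero a (hs hh 0) _)
      rw [lint_cell W a (hs hh 0)]
      exact hW _ (isCube_ccell a (hs hh 0) _)
    rw [← lintegral_const_mul' _ _ (ENNReal.rpow_lt_top_of_nonneg he.le hfin).ne]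
    refine setLIntegral_congr_fun (measurableSet_cell _ _ _) fun x hx => ?_
    have hx : idx a (h / 2 ^ 0) x = c₀ := hx
    simp only [dmax, dav, hx]
  | succ k ih =>
    have h1 := step hW hh he hK V hVf hV hD k c₀
    have hf : K * D * ∫⁻ x in cell a (h / 2 ^ 0) c₀, dmax W a h k x ^ (1 + e) ≠ ⊤ :=
      ENNReal.mul_ne_top (ENNReal.mul_ne_top hK (by rw [hD]; exact ENNReal.ofReal_ne_top)) (int_dmax_ne_top hW hh he k c₀)
    refine (ENNReal.add_le_add_iff_right hf).1 (h1.trans ?_)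
    refine (add_le_add_left ih _).trans_eq ?_
    ring

lemma dav_le_hlMax (hh : 0 < h) {j k : ℕ} (hjk : k ≤ j) (x : Fin n → ℝ) :
    dav W a h j x ≤ hlMax n ((ccell a (h / 2 ^ k) (idx a (h / 2 ^ k) x)).indicator W) x := by
  have e1 : dav W a h j x = avgL (ccell a (h / 2 ^ j) (idx a (h / 2 ^ j) x))
      ((ccell a (h / 2 ^ k) (idx a (h / 2 ^ k) x)).indicator W) := by
    rw [← avg_cell _ a (hs hh j), dav, avgL, avgL]
    congr 1
    refine setLIntegral_congr_fun (measurableSet_cell _ _ _) fun y hy => ?_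
    rw [Set.indicator_of_mem]
    exact cell_subset a (hs hh k) _ (idx_le a h hjk hy)
  rw [e1, hlMax]
  exact le_iSup_of_le _ (le_iSup_of_le (isCube_ccell a (hs hh j) _)
    (le_iSup_of_le (cell_subset a (hs hh j) _ rfl) le_rfl))

/-- Core estimate. -/
lemma core (hW : ∀ Q : Set (Fin n → ℝ), IsCube Q → ∫⁻ x in Q, W x ≠ ⊤) (hh : 0 < h)
    {e : ℝ} (he : 0 < e) {K : ℝ≥0∞} (hK : K ≠ ⊤)
    (hFW : ∀ Q : Set (Fin n → ℝ), IsCube Q →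
      ∫⁻ x in Q, hlMax n (Q.indicator W) x ≤ K * ∫⁻ x in Q, W x)
    (hKe : K * ENNReal.ofReal (2 ^ n * e) ≤ 2⁻¹) (N : ℕ) (c₀ : Fin n → ℤ) :
    ∫⁻ x in cell a (h / 2 ^ 0) c₀, dmax W a h N x ^ e * W x ≤
      2 * (avgL (cell a (h / 2 ^ 0) c₀) W ^ e * ∫⁻ x in cell a (h / 2 ^ 0) c₀, W x) := by
  set D := ENNReal.ofReal (2 ^ n * e) with hD
  have hWc : ∀ k c, ∫⁻ x in cell a (h / 2 ^ k) c, W x ≠ ⊤ := by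
    intro k c
    rw [lint_cell W a (hs hh k)]
    exact hW _ (isCube_ccell a (hs hh k) _)
  have hcell : ∀ k x, (∀ y ∈ cell a (h / 2 ^ k) (idx a (h / 2 ^ k) x), ∀ j < k,
      dav W a h j y ≤ dav W a h k y) →
      ∫⁻ y in cell a (h / 2 ^ k) (idx a (h / 2 ^ k) x), dmax W a h N y ≤
        K * ∫⁻ y in cell a (h / 2 ^ k) (idx a (h / 2 ^ k) x), W y := by
    intro k x H
    rw [lint_cell W a (hs hh k)]
    refine le_trans ?_ (hFW _ (isCube_ccell a (hs hh k) _))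
    rw [← lint_cell _ a (hs hh k)]
    refine setLIntegral_mono' (measurableSet_cell _ _ _) fun y hy => ?_
    have hy' : idx a (h / 2 ^ k) y = idx a (h / 2 ^ k) x := hy
    refine dmax_le _ _ _ _ _ _ fun j => ?_
    rw [← hy']
    rcases lt_or_ge j k with hj | hj
    · exact (H y hy j hj).trans (dav_le_hlMax hh le_rfl y)
    · exact dav_le_hlMax hh hj y
  have hMf : ∀ k c, ∫⁻ x in cell a (h / 2 ^ k) c, dmax W a h N x ≠ ⊤ := by
    intro k c
    obtain ⟨x₀, hx₀⟩ : (cell a (h / 2 ^ k) c).Nonempty :=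
      nonempty_of_measure_ne_zero (vol_ne_zero a (hs hh k) c)
    have hx₀ : idx a (h / 2 ^ k) x₀ = c := hx₀
    have hle : ∫⁻ x in cell a (h / 2 ^ k) c, dmax W a h N x ≤
        ∫⁻ x in cell a (h / 2 ^ k) c, (2 ^ n) ^ N * dav W a h 0 x₀ := by
      refine setLIntegral_mono' (measurableSet_cell _ _ _) fun y hy => ?_
      have hy' : idx a (h / 2 ^ k) y = idx a (h / 2 ^ k) x₀ := by rw [hx₀]; exact hy
      rw [← dav_congr W a h (Nat.zero_le k) hy']
      exact dmax_bound hh N y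
    refine (hle.trans_lt ?_).ne
    rw [setLIntegral_const]
    exact ENNReal.mul_lt_top (ENNReal.mul_lt_top (by simp) (dav_ne_top hW hh 0 x₀).lt_top)
      (vol_ne_top a (hs hh k) _).lt_top
  have hA := iter hW hh he hK (dmax W a h N) hMf (fun k x hx => hcell (k+1) x (by
    intro y hy j hj
    have hy' : idx a (h / 2 ^ (k+1)) y = idx a (h / 2 ^ (k+1)) x := hy
    rw [← dmax_congr W a h (Nat.le_succ k) hy', ← dav_congr W a h le_rfl hy'] at hx
    exact (dav_le_dmax W a h (by omega) y).trans hx.le)) hD N c₀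
  have hB := iter hW hh he ENNReal.one_ne_top W hWc (fun k x _ => by rw [one_mul]) hD N c₀
  set S := ∫⁻ x in cell a (h / 2 ^ 0) c₀, dmax W a h N x ^ (1 + e) with hS
  have hSf : S ≠ ⊤ := int_dmax_ne_top hW hh he N c₀
  set u := avgL (cell a (h / 2 ^ 0) c₀) W ^ e
  set I := ∫⁻ x in cell a (h / 2 ^ 0) c₀, W x
  have hS' : ∫⁻ x in cell a (h / 2 ^ 0) c₀, dmax W a h N x ^ e * dmax W a h N x = S := by
    rw [hS]
    refine lintegral_congr fun x => ?_
    rw [add_comm 1 e, ENNReal.rpow_add_of_nonneg _ _ he.le zero_le_one, ENNReal.rpow_one]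
  rw [hS'] at hA
  have h0 : ∫⁻ x in cell a (h / 2 ^ 0) c₀, dmax W a h N x ≤ K * I := by
    obtain ⟨x₀, hx₀⟩ : (cell a (h / 2 ^ 0) c₀).Nonempty :=
      nonempty_of_measure_ne_zero (vol_ne_zero a (hs hh 0) c₀)
    have hx₀ : idx a (h / 2 ^ 0) x₀ = c₀ := hx₀
    have := hcell 0 x₀ (by intro y _ j hj; omega)
    rwa [hx₀] at this
  have h1 : S ≤ u * (K * I) + 2⁻¹ * S := hA.trans (by gcongr)
  have h2 : 2⁻¹ * S ≤ u * (K * I) := by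
    have hf : 2⁻¹ * S ≠ ⊤ := ENNReal.mul_ne_top (by simp) hSf
    refine (ENNReal.add_le_add_iff_right hf).1 ?_
    rwa [← add_mul, ENNReal.inv_two_add_inv_two, one_mul]
  have h3 : S ≤ 2 * (u * (K * I)) := by
    calc S = 2 * (2⁻¹ * S) := by
          rw [← mul_assoc, ENNReal.mul_inv_cancel (by simp) (by simp), one_mul]
      _ ≤ _ := by gcongr
  calc _ ≤ u * I + 1 * D * S := hB
    _ ≤ u * I + 1 * D * (2 * (u * (K * I))) := by gcongr
    _ = u * I + 2 * (K * D) * (u * I) := by ring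
    _ ≤ u * I + 2 * 2⁻¹ * (u * I) := by gcongr
    _ = 2 * (u * I) := by
      rw [ENNReal.mul_inv_cancel (by simp) (by simp)]; ring

lemma ccell_eq_ball {s : ℝ} (c : Fin n → ℤ) (hs' : 0 < s) :
    ccell a s c = Metric.closedBall (fun i => low a s c i + s / 2) (s / 2) := by
  rw [closedBall_pi _ (by positivity), ccell, ← Set.pi_univ_Icc]
  congr 1
  funext i
  rw [Real.closedBall_eq_Icc]
  congr 1
  · ring
  · simp only [Pi.add_apply]; ring

lemma ae_tendsto_dav {w : (Fin n → ℝ) → ℝ} (hw : IsWeight n w) (hh : 0 < h) :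
    ∀ᵐ x, Filter.Tendsto (fun k => dav (fun y => ENNReal.ofReal (w y)) a h k x) Filter.atTop
      (nhds (ENNReal.ofReal (w x))) := by
  filter_upwards [IsUnifLocDoublingMeasure.ae_tendsto_average volume hw.1 1] with x hx
  have hlim : Filter.Tendsto (fun k : ℕ => h / 2 ^ k / 2) Filter.atTop (nhdsWithin 0 (Set.Ioi 0)) := by
    refine tendsto_nhdsWithin_iff.2 ⟨?_, Filter.Eventually.of_forall fun k => ?_⟩
    · have := (tendsto_pow_atTop_nhds_zero_of_lt_one (r := (1/2:ℝ)) (by norm_num)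
        (by norm_num)).const_mul (h / 2)
      rw [mul_zero] at this
      refine this.congr fun k => ?_
      rw [one_div, inv_pow]; field_simp
    · have := hs hh k
      simp only [Set.mem_Ioi]; positivity
  have h1 := hx (fun k i => low a (h / 2 ^ k) (idx a (h / 2 ^ k) x) i + h / 2 ^ k / 2)
    (fun k => h / 2 ^ k / 2) hlim (Filter.Eventually.of_forall fun k => by
      rw [one_mul, ← ccell_eq_ball _ (hs hh k)]
      exact cell_subset a (hs hh k) _ rfl)
  refine ((ENNReal.continuous_ofReal.tendsto _).comp h1).congr fun k => ?_
  simp only [Function.comp]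
  rw [← ccell_eq_ball _ (hs hh k), dav, avg_cell _ a (hs hh k), avgL, ofReal_setAverage]
  · exact hw.1.integrableOn_isCompact isCompact_Icc
  · exact ae_restrict_of_ae (hw.2.mono fun y hy => hy.le)

end

end SRH

/-- **Sharp reverse Hölder inequality.** There is `ε_n > 0` such that any weight
`w` with `[w]_{A_∞} < ∞` satisfies the reverse Hölder inequality
`(⨍_Q w^q)^{1/q} ≤ 2 ⨍_Q w` on every cube, for every `1 < q ≤ 1 + ε_n/[w]_{A_∞}`. -/
theorem sharp_reverse_holder (n : ℕ) :
    ∃ ε : ℝ, 0 < ε ∧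
      ∀ w : (Fin n → ℝ) → ℝ, IsWeight n w → fwConst n w ≠ ⊤ →
      ∀ q : ℝ, 1 < q →
        ENNReal.ofReal q ≤ 1 + ENNReal.ofReal ε / fwConst n w →
        ∀ Q : Set (Fin n → ℝ), IsCube Q →
          (avgL Q fun x => ENNReal.ofReal (w x) ^ q) ^ (1 / q) ≤
            2 * avgL Q fun x => ENNReal.ofReal (w x) := by
  refine ⟨1 / 2 ^ (n+1), by positivity, ?_⟩
  intro w hw hK q hq hqK Q hQ
  have hW : ∀ Q : Set (Fin n → ℝ), IsCube Q → ∫⁻ x in Q, ENNReal.ofReal (w x) ≠ ⊤ := by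
    rintro Q ⟨a, h, hh, rfl⟩
    exact (hw.1.integrableOn_isCompact isCompact_Icc).lintegral_lt_top.ne
  have hvol : ∀ Q : Set (Fin n → ℝ), IsCube Q → volume Q ≠ 0 ∧ volume Q ≠ ⊤ := by
    rintro Q ⟨a, h, hh, rfl⟩
    rw [Real.volume_Icc_pi]
    simp [hh]
  have hW0 : ∀ Q : Set (Fin n → ℝ), IsCube Q → ∫⁻ x in Q, ENNReal.ofReal (w x) ≠ 0 := by
    intro Q hQ h0
    rw [lintegral_eq_zero_iff'] at h0
    · have h1 : ∀ᵐ x ∂(volume.restrict Q), False := by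
        filter_upwards [h0, ae_restrict_of_ae hw.2] with x hx hx'
        simp only [Pi.zero_apply, ENNReal.ofReal_eq_zero] at hx
        linarith
      rw [Filter.eventually_false_iff_eq_bot, ae_eq_bot, Measure.restrict_eq_zero] at h1
      exact (hvol Q hQ).1 h1
    · exact hw.1.aestronglyMeasurable.aemeasurable.ennreal_ofReal.restrict
  have hFW : ∀ Q : Set (Fin n → ℝ), IsCube Q →
      ∫⁻ x in Q, hlMax n (Q.indicator fun y => ENNReal.ofReal (w y)) x ≤
        fwConst n w * ∫⁻ x in Q, ENNReal.ofReal (w x) := by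
    intro Q hQ
    rw [← ENNReal.div_le_iff (hW0 Q hQ) (hW Q hQ)]
    exact le_iSup₂_of_le Q hQ le_rfl
  have hK0 : fwConst n w ≠ 0 := by
    intro h0
    have h1 := hFW Q hQ
    rw [h0, zero_mul] at h1
    have h2 : ∫⁻ x in Q, ENNReal.ofReal (w x) ≤
        ∫⁻ x in Q, hlMax n (Q.indicator fun y => ENNReal.ofReal (w y)) x := by
      have hm : MeasurableSet Q := by
        obtain ⟨a, h, hh, rfl⟩ := hQ
        exact measurableSet_Icc
      calc _ = ∫⁻ x in Q, avgL Q (Q.indicator fun y => ENNReal.ofReal (w y)) := by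
            rw [setLIntegral_const, avgL, ENNReal.div_mul_cancel (hvol Q hQ).1 (hvol Q hQ).2]
            exact setLIntegral_congr_fun hm fun x hx =>
              (Set.indicator_of_mem hx (fun y => ENNReal.ofReal (w y))).symm
        _ ≤ _ := setLIntegral_mono' hm fun x hx => by
            rw [hlMax]
            exact le_iSup_of_le Q (le_iSup_of_le hQ (le_iSup_of_le hx le_rfl))
    exact hW0 Q hQ (le_antisymm (h2.trans h1) zero_le)
  obtain ⟨a, h, hh, rfl⟩ := hQ
  obtain ⟨e, rfl⟩ : ∃ e, q = 1 + e := ⟨q - 1, by ring⟩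
  have he : 0 < e := by linarith
  have hKe : fwConst n w * ENNReal.ofReal (2 ^ n * e) ≤ 2⁻¹ := by
    rw [ENNReal.ofReal_add zero_le_one he.le, ENNReal.ofReal_one,
      ENNReal.add_le_add_iff_left ENNReal.one_ne_top, ENNReal.le_div_iff_mul_le (Or.inl hK0)
      (Or.inl hK)] at hqK
    calc fwConst n w * ENNReal.ofReal (2 ^ n * e)
        = ENNReal.ofReal (2 ^ n) * (ENNReal.ofReal e * fwConst n w) := by
          rw [ENNReal.ofReal_mul (by positivity)]; ring
      _ ≤ ENNReal.ofReal (2 ^ n) * ENNReal.ofReal (1 / 2 ^ (n+1)) := by gcongr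
      _ = ENNReal.ofReal (2⁻¹) := by
          rw [← ENNReal.ofReal_mul (by positivity)]
          congr 1
          rw [pow_succ]; field_simp
      _ = 2⁻¹ := by rw [ENNReal.ofReal_inv_of_pos (by norm_num)]; simp
  set W : (Fin n → ℝ) → ℝ≥0∞ := fun x => ENNReal.ofReal (w x) with hWdef
  have hQe : Set.Icc a (a + fun _ => h) = SRH.ccell a (h / 2 ^ 0) 0 := by
    have : SRH.low a (h / 2 ^ 0) 0 = a := by funext i; simp [SRH.low]
    rw [SRH.ccell, this]; simp
  have hs0 := SRH.hs hh 0
  rw [hQe, ← SRH.avg_cell _ a hs0, ← SRH.avg_cell _ a hs0]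
  set P := SRH.cell a (h / 2 ^ 0) 0 with hP
  have hWm : AEMeasurable W volume := hw.1.aestronglyMeasurable.aemeasurable.ennreal_ofReal
  have hfatou : ∫⁻ x in P, W x ^ (1 + e) ≤ 2 * (avgL P W ^ e * ∫⁻ x in P, W x) := by
    calc ∫⁻ x in P, W x ^ (1 + e)
        = ∫⁻ x in P, Filter.liminf (fun k => SRH.dav W a h k x ^ e * W x) Filter.atTop := by
          refine lintegral_congr_ae (ae_restrict_of_ae ?_)
          filter_upwards [SRH.ae_tendsto_dav (a := a) hw hh] with x hx
          have h1 : Filter.Tendsto (fun k => SRH.dav W a h k x ^ e * W x) Filter.atTop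
              (nhds (W x ^ e * W x)) := by
            refine ENNReal.Tendsto.mul_const (hx.ennrpow_const e) (Or.inr ENNReal.ofReal_ne_top)
          rw [h1.liminf_eq, add_comm 1 e,
            ENNReal.rpow_add_of_nonneg _ _ he.le zero_le_one, ENNReal.rpow_one]
      _ ≤ Filter.liminf (fun k => ∫⁻ x in P, SRH.dav W a h k x ^ e * W x) Filter.atTop :=
          lintegral_liminf_le' fun k =>
            (((SRH.measurable_dav W a h k).pow_const e).aemeasurable.mul hWm.restrict)
      _ ≤ 2 * (avgL P W ^ e * ∫⁻ x in P, W x) := by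
          refine Filter.liminf_le_of_le (by isBoundedDefault) fun b hb => ?_
          obtain ⟨k, hk⟩ := hb.exists
          refine hk.trans (le_trans ?_ (SRH.core hW hh he hK hFW hKe k 0))
          refine lintegral_mono fun x => ?_
          gcongr
          exact SRH.dav_le_dmax W a h le_rfl x
  have hfin : avgL P (fun x => W x ^ (1 + e)) ≤ 2 * avgL P W ^ (1 + e) := by
    rw [add_comm 1 e, ENNReal.rpow_add_of_nonneg _ _ he.le zero_le_one, ENNReal.rpow_one,
      add_comm e 1]
    calc avgL P (fun x => W x ^ (1 + e)) ≤ (2 * (avgL P W ^ e * ∫⁻ x in P, W x)) / volume P :=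
          ENNReal.div_le_div_right hfatou _
      _ = 2 * (avgL P W ^ e * avgL P W) := by
          rw [mul_div_assoc, mul_div_assoc]; rfl
  calc _ ≤ (2 * avgL P W ^ (1 + e)) ^ (1 / (1 + e)) :=
        ENNReal.rpow_le_rpow hfin (by positivity)
    _ = 2 ^ (1 / (1 + e)) * avgL P W := by
        rw [ENNReal.mul_rpow_of_nonneg _ _ (by positivity), ← ENNReal.rpow_mul,
          mul_one_div_cancel (by linarith), ENNReal.rpow_one]
    _ ≤ 2 ^ (1:ℝ) * avgL P W := by
        gcongr
        · norm_num
        · rw [div_le_one (by linarith)]; linarith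
    _ = _ := by rw [ENNReal.rpow_one]

end
end
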